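/- arXiv:2312.09605 — 2 statements merged into one kernel-verified Lean document; each statement's English description precedes it below -/
import Mathlib

section
/- Let χ : ℝ → ℝ be a smooth compactly supported function that is equal to 1 in a neighbourhood of 0, and fix one of the two signs ±. There exists a constant C > 0 such that for every Schwartz function f on ℝ, every real t ≠ 0, every μ ∈ (0,1] and every ε ∈ (0,1], the Fourier multiplier with symbol e^{± i (t/ε) ξ (1 + μξ²/3)^{-1/2}} χ(√μ |ξ|) sgn(ξ) |ξ|^{1/2} satisfies ‖e^{±(t/ε) ∂ₓ/√(1+μD²/3)} χ(√μ|D|) sgn(D) |D|^{1/2} f‖_{L^∞(ℝ)} ≤ C μ^{-1/2} (ε/|t|)^{1/2} ‖χ(√μ|D|) f‖_{L¹(ℝ)}. -/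
open MeasureTheory Real Complex
open scoped ENNReal

/-- One-dimensional Fourier transform with the convention
`f̂(ξ) = (2π)^{-1/2} ∫ e^{-i x ξ} f(x) dx`. -/
noncomputable def ft1 (f : ℝ → ℂ) (ξ : ℝ) : ℂ :=
  (((2 * π) ^ (-(1 : ℝ) / 2) : ℝ) : ℂ) * ∫ x : ℝ, Complex.exp (-Complex.I * (x * ξ : ℝ)) * f x

/-- One-dimensional Fourier multiplier `m(D) f (x) = (2π)^{-1/2} ∫ e^{i x ξ} m(ξ) f̂(ξ) dξ`. -/
noncomputable def fmult1 (m : ℝ → ℂ) (f : ℝ → ℂ) (x : ℝ) : ℂ :=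
  (((2 * π) ^ (-(1 : ℝ) / 2) : ℝ) : ℂ) *
    ∫ ξ : ℝ, Complex.exp (Complex.I * (x * ξ : ℝ)) * m ξ * ft1 f ξ

/-- Symbol `e^{σ i τ ξ (1 + μ ξ²/3)^{-1/2}}` of the free propagator
`e^{σ τ ∂ₓ/√(1+μD²/3)}` of the linearized 1D classical Boussinesq system (`σ = ±1`). -/
noncomputable def prop1 (σ τ μ : ℝ) (ξ : ℝ) : ℂ :=
  Complex.exp (Complex.I * ((σ * τ * ξ / Real.sqrt (1 + μ * ξ ^ 2 / 3) : ℝ) : ℂ))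

/-- van der Corput type estimate -/
lemma vdc_abs {δ R : ℝ} (hδR : δ ≤ R) (φ a P P' M M' b b' : ℝ → ℝ) {s c Λ B : ℝ}
    (hs : 0 < s) (hc : 0 < c) (hΛ : 0 < Λ) (hsΛ : s ^ 2 = Λ)
    (hφ : ∀ x ∈ Set.Icc δ R, HasDerivAt φ (a x * P x) x)
    (hP : ∀ x ∈ Set.Icc δ R, HasDerivAt P (P' x) x)
    (hM : ∀ x ∈ Set.Icc δ R, HasDerivAt M (M' x) x)
    (hb : ∀ x ∈ Set.Icc δ R, HasDerivAt b (b' x) x)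
    (ha : ContinuousOn a (Set.Icc δ R))
    (ha0 : ∀ x ∈ Set.Icc δ R, 0 ≤ a x)
    (hPM : ∀ x ∈ Set.Icc δ R, |M x| ≤ |P x|)
    (hPM' : ∀ x ∈ Set.Icc δ R, |P' x| ≤ M' x)
    (hMa : ∀ x ∈ Set.Icc δ R, c * Λ * a x ≤ M' x)
    (hb0 : ∀ x ∈ Set.Icc δ R, 0 ≤ b x)
    (hbB : ∀ x ∈ Set.Icc δ R, b x ≤ B)
    (hb' : ∀ x ∈ Set.Icc δ R, 0 ≤ b' x) :
    ‖∫ x in δ..R, Complex.exp (Complex.I * (φ x : ℂ)) * ((a x * b x : ℝ) : ℂ)‖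
      ≤ (2 + (1 / c + 1) * π) * B / s := by
  set Q : ℝ → ℝ := fun x => P x / (P x ^ 2 + s ^ 2) with hQ
  have hden : ∀ x, 0 < P x ^ 2 + s ^ 2 := fun x => by positivity
  set Q' : ℝ → ℝ := fun x => P' x * (s ^ 2 - P x ^ 2) / (P x ^ 2 + s ^ 2) ^ 2 with hQ'
  have hQd : ∀ x ∈ Set.Icc δ R, HasDerivAt Q (Q' x) x := by
    intro x hx
    have h1 := (hP x hx).div (((hP x hx).pow 2).add_const (s ^ 2)) (hden x).ne'
    refine h1.congr_deriv ?_
    simp only [hQ', Pi.pow_apply]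
    congr 1
    push_cast
    ring
  set F : ℝ → ℂ := fun x => Complex.exp (Complex.I * (φ x : ℂ)) *
    (-Complex.I * ((Q x * b x : ℝ) : ℂ)) with hF
  set w : ℝ → ℂ := fun x => Complex.exp (Complex.I * (φ x : ℂ)) * ((a x * b x : ℝ) : ℂ) with hw
  have hφc : ContinuousOn φ (Set.Icc δ R) := fun x hx => (hφ x hx).continuousAt.continuousWithinAt
  have hbc : ContinuousOn b (Set.Icc δ R) := fun x hx => (hb x hx).continuousAt.continuousWithinAt
  have hQc : ContinuousOn Q (Set.Icc δ R) := fun x hx => (hQd x hx).continuousAt.continuousWithinAt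
  have hMc : ContinuousOn M (Set.Icc δ R) := fun x hx => (hM x hx).continuousAt.continuousWithinAt
  have hwc : ContinuousOn w (Set.Icc δ R) := by
    apply ContinuousOn.mul
    · exact Complex.continuous_exp.comp_continuousOn
        (continuousOn_const.mul (Complex.continuous_ofReal.comp_continuousOn hφc))
    · exact Complex.continuous_ofReal.comp_continuousOn (ha.mul hbc)
  have hFd : ∀ x ∈ Set.Icc δ R, HasDerivAt F (Complex.exp (Complex.I * (φ x : ℂ)) *
      (((a x * P x * (Q x * b x) : ℝ) : ℂ) - Complex.I * ((Q' x * b x + Q x * b' x : ℝ) : ℂ))) x := by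
    intro x hx
    have h1 := (((hφ x hx).ofReal_comp).const_mul Complex.I).cexp
    have h2 := (((hQd x hx).mul (hb x hx)).ofReal_comp).const_mul (-Complex.I)
    refine (h1.mul h2).congr_deriv ?_
    push_cast
    simp only [Pi.mul_apply]
    push_cast
    linear_combination (-Complex.exp (Complex.I * (φ x : ℂ)) * (a x * P x * (Q x * b x) : ℂ)) *
      Complex.I_sq
  set H : ℝ → ℝ := fun x => ((1 / c + 1) * B / s) * Real.arctan (M x / s) + b x / (2 * s) with hH
  have hHd : ∀ x ∈ Set.Icc δ R, HasDerivAt H (((1 / c + 1) * B) * (M' x / (M x ^ 2 + s ^ 2))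
      + b' x / (2 * s)) x := by
    intro x hx
    have h1 := ((((hM x hx).div_const s).arctan).const_mul ((1 / c + 1) * B / s)).add
      ((hb x hx).div_const (2 * s))
    refine h1.congr_deriv ?_
    have : 0 < M x ^ 2 + s ^ 2 := by positivity
    congr 1
    field_simp
    ring
  set E : ℝ → ℂ := fun x => (∫ u in δ..x, w u) - (F x - F δ) with hE
  have hQbound : ∀ x, |Q x| ≤ 1 / (2 * s) := by
    intro x
    rw [hQ]
    simp only
    rw [abs_div, abs_of_pos (hden x), div_le_div_iff₀ (hden x) (by positivity)]
    nlinarith [sq_nonneg (|P x| - s), sq_abs (P x)]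
  have hE' : ∀ x ∈ Set.Icc δ R, ‖w x - Complex.exp (Complex.I * (φ x : ℂ)) *
      (((a x * P x * (Q x * b x) : ℝ) : ℂ) - Complex.I * ((Q' x * b x + Q x * b' x : ℝ) : ℂ))‖ ≤
      ((1 / c + 1) * B) * (M' x / (M x ^ 2 + s ^ 2)) + b' x / (2 * s) := by
    intro x hx
    have e1 : w x - Complex.exp (Complex.I * (φ x : ℂ)) *
      (((a x * P x * (Q x * b x) : ℝ) : ℂ) - Complex.I * ((Q' x * b x + Q x * b' x : ℝ) : ℂ))
      = Complex.exp (Complex.I * (φ x : ℂ)) * (((a x * b x * (s ^ 2 / (P x ^ 2 + s ^ 2)) : ℝ) : ℂ) +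
        Complex.I * ((Q' x * b x + Q x * b' x : ℝ) : ℂ)) := by
      have : a x * b x - a x * P x * (Q x * b x) = a x * b x * (s ^ 2 / (P x ^ 2 + s ^ 2)) := by
        rw [hQ]
        have := (hden x).ne'
        field_simp
        ring
      rw [← this, hw]
      push_cast
      ring
    rw [e1, norm_mul, mul_comm Complex.I (φ x : ℂ), Complex.norm_exp_ofReal_mul_I, one_mul]
    refine (norm_add_le _ _).trans ?_
    rw [norm_mul, Complex.norm_I, one_mul, Complex.norm_real, Complex.norm_real, Real.norm_eq_abs,
      Real.norm_eq_abs]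
    have hMd : 0 < M x ^ 2 + s ^ 2 := by positivity
    have hsq : M x ^ 2 ≤ P x ^ 2 := sq_le_sq.mpr (hPM x hx)
    have hM'0 : 0 ≤ M' x := (abs_nonneg _).trans (hPM' x hx)
    have hB0 : 0 ≤ B := (hb0 x hx).trans (hbB x hx)
    have t1 : |a x * b x * (s ^ 2 / (P x ^ 2 + s ^ 2))| ≤ (1 / c) * B * (M' x / (M x ^ 2 + s ^ 2)) := by
      have ha' := ha0 x hx
      have hb'' := hb0 x hx
      rw [abs_of_nonneg (by positivity)]
      have h1 : a x * s ^ 2 ≤ 1 / c * M' x := by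
        have := hMa x hx
        rw [hsΛ, div_mul_eq_mul_div, le_div_iff₀ hc]
        linarith
      calc a x * b x * (s ^ 2 / (P x ^ 2 + s ^ 2)) = (a x * s ^ 2) * b x / (P x ^ 2 + s ^ 2) := by ring
        _ ≤ (1 / c * M' x) * B / (M x ^ 2 + s ^ 2) := by
          gcongr
          exact hbB x hx
        _ = _ := by ring
    have t2 : |Q' x| ≤ M' x / (M x ^ 2 + s ^ 2) := by
      rw [hQ']
      simp only
      rw [abs_div, abs_mul, abs_of_pos (pow_pos (hden x) 2)]
      calc |P' x| * |s ^ 2 - P x ^ 2| / (P x ^ 2 + s ^ 2) ^ 2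
          ≤ M' x * (P x ^ 2 + s ^ 2) / (P x ^ 2 + s ^ 2) ^ 2 := by
            gcongr
            · exact hPM' x hx
            · rw [abs_le]; constructor <;> nlinarith [sq_nonneg (P x), sq_nonneg s]
        _ = M' x / (P x ^ 2 + s ^ 2) := by
            have := (hden x).ne'
            field_simp
        _ ≤ _ := by gcongr
    have t3 : |Q' x * b x + Q x * b' x| ≤ B * (M' x / (M x ^ 2 + s ^ 2)) + b' x / (2 * s) := by
      refine (abs_add_le _ _).trans ?_
      rw [abs_mul, abs_mul, abs_of_nonneg (hb0 x hx), abs_of_nonneg (hb' x hx)]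
      have h3 : |Q' x| * b x ≤ (M' x / (M x ^ 2 + s ^ 2)) * B := by
        gcongr
        · exact hb0 x hx
        · exact hbB x hx
      have h4 : |Q x| * b' x ≤ 1 / (2 * s) * b' x :=
        mul_le_mul_of_nonneg_right (hQbound x) (hb' x hx)
      calc _ ≤ _ := add_le_add h3 h4
        _ = _ := by ring
    calc _ ≤ _ := add_le_add t1 t3
      _ = _ := by ring
  have hwi : IntervalIntegrable w volume δ R := by
    apply ContinuousOn.intervalIntegrable
    rwa [Set.uIcc_of_le hδR]
  have hEc : ContinuousOn E (Set.Icc δ R) := by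
    apply ContinuousOn.sub
    · have := intervalIntegral.continuousOn_primitive_interval' (μ := volume) hwi (a := δ) (by simp)
      rwa [Set.uIcc_of_le hδR] at this
    · exact ContinuousOn.sub (fun x hx => (hFd x hx).continuousAt.continuousWithinAt)
        continuousOn_const
  have hEd : ∀ x ∈ Set.Ico δ R, HasDerivWithinAt E (w x - Complex.exp (Complex.I * (φ x : ℂ)) *
      (((a x * P x * (Q x * b x) : ℝ) : ℂ) - Complex.I * ((Q' x * b x + Q x * b' x : ℝ) : ℂ)))
      (Set.Ici x) x := by
    intro x hx
    have hx' : x ∈ Set.Icc δ R := ⟨hx.1, hx.2.le⟩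
    refine HasDerivWithinAt.sub ?_ ((hFd x hx').hasDerivWithinAt.sub_const _)
    have hnhds : Set.Icc x R ∈ nhdsWithin x (Set.Ioi x) := Icc_mem_nhdsGT hx.2
    have hsub : Set.Icc x R ⊆ Set.Icc δ R := Set.Icc_subset_Icc_left hx.1
    have hwcx : ContinuousWithinAt w (Set.Ioi x) x :=
      ((hwc x hx').mono hsub).mono_of_mem_nhdsWithin hnhds
    refine intervalIntegral.integral_hasDerivWithinAt_right (t := Set.Ioi x)
      (hwi.mono_set ?_) ?_ hwcx
    · rw [Set.uIcc_of_le hx.1, Set.uIcc_of_le hδR]; exact Set.Icc_subset_Icc_right hx.2.le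
    · exact ⟨Set.Icc x R, hnhds, (hwc.mono hsub).aestronglyMeasurable measurableSet_Icc⟩
  have key : ‖E R‖ ≤ H R - H δ := by
    refine image_norm_le_of_norm_deriv_right_le_deriv_boundary' (a := δ) (b := R) hEc hEd
      (B := fun x => H x - H δ) ?_ ?_ (fun x hx => ((hHd x ⟨hx.1, hx.2.le⟩).sub_const _).hasDerivWithinAt)
      (fun x hx => hE' x ⟨hx.1, hx.2.le⟩) ⟨hδR, le_rfl⟩
    · simp [hE]
    · exact fun x hx => ((hHd x hx).sub_const _).continuousAt.continuousWithinAt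
  have hRm : R ∈ Set.Icc δ R := ⟨hδR, le_rfl⟩
  have hδm : δ ∈ Set.Icc δ R := ⟨le_rfl, hδR⟩
  have hB0 : 0 ≤ B := (hb0 R hRm).trans (hbB R hRm)
  have hHb : H R - H δ ≤ (1 / c + 1) * B / s * π + B / (2 * s) := by
    have h1 := Real.arctan_lt_pi_div_two (M R / s)
    have h2 := Real.neg_pi_div_two_lt_arctan (M δ / s)
    have h3 : Real.arctan (M R / s) - Real.arctan (M δ / s) ≤ π := by linarith
    have h4 : 0 ≤ (1 / c + 1) * B / s := by positivity
    have h5 := mul_le_mul_of_nonneg_left h3 h4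
    have h6 : b R / (2 * s) - b δ / (2 * s) ≤ B / (2 * s) := by
      rw [← sub_div]
      gcongr
      linarith [hb0 δ hδm, hbB R hRm]
    simp only [hH]
    linarith
  have hFb : ∀ x ∈ Set.Icc δ R, ‖F x‖ ≤ B / (2 * s) := by
    intro x hx
    simp only [hF]
    rw [norm_mul, mul_comm Complex.I (φ x : ℂ), Complex.norm_exp_ofReal_mul_I, one_mul, norm_mul,
      norm_neg, Complex.norm_I, one_mul, Complex.norm_real, Real.norm_eq_abs, abs_mul,
      abs_of_nonneg (hb0 x hx)]
    calc |Q x| * b x ≤ 1 / (2 * s) * B := by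
          gcongr
          · exact hb0 x hx
          · exact hQbound x
          · exact hbB x hx
      _ = _ := by ring
  have e : (∫ x in δ..R, w x) = E R + (F R - F δ) := by simp [hE]
  rw [e]
  calc ‖E R + (F R - F δ)‖ ≤ ‖E R‖ + (‖F R‖ + ‖F δ‖) :=
        (norm_add_le _ _).trans (add_le_add le_rfl (norm_sub_le _ _))
    _ ≤ ((1 / c + 1) * B / s * π + B / (2 * s)) + (B / (2 * s) + B / (2 * s)) :=
        add_le_add (key.trans hHb) (add_le_add (hFb R hRm) (hFb δ hδm))
    _ = (3 / 2 + (1 / c + 1) * π) * B / s := by field_simp; ring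
    _ ≤ _ := by gcongr; norm_num

/-- the weight `√(1+x²/3)` -/
noncomputable def ww (x : ℝ) : ℝ := Real.sqrt (1 + x ^ 2 / 3)

/-- the amplitude -/
noncomputable def aa (x : ℝ) : ℝ := Real.sqrt (Real.sqrt (1 - 1 / ww x ^ 4))

/-- logarithmic derivative of the amplitude -/
noncomputable def ll (x : ℝ) : ℝ := x / (3 * ww x ^ 2 * (ww x ^ 4 - 1))

lemma ww_sq (x : ℝ) : ww x ^ 2 = 1 + x ^ 2 / 3 := Real.sq_sqrt (by positivity)

lemma ww_pos (x : ℝ) : 0 < ww x := Real.sqrt_pos.mpr (by positivity)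

lemma ww_ge (x : ℝ) : 1 ≤ ww x := by
  have := ww_sq x
  nlinarith [ww_pos x, sq_nonneg x]

lemma ww_gt {x : ℝ} (hx : 0 < x) : 1 < ww x := by
  have := ww_sq x
  nlinarith [ww_pos x, pow_pos hx 2]

lemma ww_mono {x y : ℝ} (hx : 0 ≤ x) (h : x ≤ y) : ww x ≤ ww y := by
  unfold ww
  gcongr

lemma ww_deriv (x : ℝ) : HasDerivAt ww (x / (3 * ww x)) x := by
  have h1 : HasDerivAt (fun x : ℝ => 1 + x ^ 2 / 3) (2 * x / 3) x := by
    have := ((hasDerivAt_pow 2 x).div_const 3).const_add 1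
    simpa using this
  have h2 := h1.sqrt (by positivity)
  refine h2.congr_deriv ?_
  change 2 * x / 3 / (2 * ww x) = _
  have := (ww_pos x).ne'
  field_simp

lemma ww4_gt {x : ℝ} (hx : 0 < x) : 1 < ww x ^ 4 := one_lt_pow₀ (ww_gt hx) (by norm_num)

lemma inner_pos {x : ℝ} (hx : 0 < x) : 0 < 1 - 1 / ww x ^ 4 := by
  have h := ww4_gt hx
  have : 1 / ww x ^ 4 < 1 := by rw [div_lt_one (by linarith)]; exact h
  linarith

lemma aa_pos {x : ℝ} (hx : 0 < x) : 0 < aa x :=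
  Real.sqrt_pos.mpr (Real.sqrt_pos.mpr (inner_pos hx))

lemma aa_deriv {x : ℝ} (hx : 0 < x) : HasDerivAt aa (aa x * ll x) x := by
  have hw := ww_pos x
  have hi := inner_pos hx
  have h4 := ww4_gt hx
  have h1 : HasDerivAt (fun x : ℝ => 1 - 1 / ww x ^ 4) (4 * x / (3 * ww x ^ 6)) x := by
    have := (((ww_deriv x).pow 4).inv (by positivity)).const_sub 1
    have h := this.congr_deriv (g' := 4 * x / (3 * ww x ^ 6)) (by
      simp only [Pi.pow_apply]
      field_simp
      push_cast
      ring)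
    refine h.congr_of_eventuallyEq (Filter.Eventually.of_forall fun z => ?_)
    simp [one_div]
  have h2 := (h1.sqrt hi.ne').sqrt (Real.sqrt_pos.mpr hi).ne'
  refine h2.congr_deriv ?_
  change _ / _ / (2 * aa x) = _
  have ha := aa_pos hx
  have ha2 : aa x ^ 2 = Real.sqrt (1 - 1 / ww x ^ 4) := Real.sq_sqrt (Real.sqrt_nonneg _)
  have ha4 : aa x ^ 4 = 1 - 1 / ww x ^ 4 := by
    rw [show aa x ^ 4 = (aa x ^ 2) ^ 2 by ring, ha2, Real.sq_sqrt hi.le]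
  have ha4' : aa x ^ 4 * ww x ^ 4 = ww x ^ 4 - 1 := by rw [ha4]; field_simp
  rw [← ha2, ll, ← ha4']
  field_simp
  ring

lemma aa_sq_le {x : ℝ} (hx : 0 < x) : aa x ^ 2 ≤ x := by
  have hw := ww_ge x
  rw [aa, Real.sq_sqrt (Real.sqrt_nonneg _)]
  apply Real.sqrt_le_iff.mpr ⟨hx.le, ?_⟩
  have h2 := ww_sq x
  have h4 : ww x ^ 4 = (1 + x ^ 2 / 3) ^ 2 := by rw [← h2]; ring
  rw [h4, sub_le_iff_le_add, ← sub_le_iff_le_add', le_div_iff₀ (by positivity)]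
  nlinarith [pow_pos hx 2, pow_pos hx 4, pow_pos hx 6]

lemma ll_pos {x : ℝ} (hx : 0 < x) : 0 < ll x := by
  have h4 := ww4_gt hx
  have hw := ww_pos x
  have : 0 < ww x ^ 4 - 1 := by linarith
  unfold ll
  positivity

/-- bound for the logarithmic derivative term -/
lemma gl_le {x : ℝ} (hx : 0 < x) : (1 - 1 / ww x ^ 3) * ll x ≤ x / ww x ^ 5 / 3 := by
  have h4 := ww4_gt hx
  have hw := ww_pos x
  have hw1 := ww_ge x
  have hd : 0 < ww x ^ 4 - 1 := by linarith
  have e : (1 - 1 / ww x ^ 3) * ll x = x / ww x ^ 5 / 3 * ((ww x ^ 3 - 1) / (ww x ^ 4 - 1)) := by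
    unfold ll
    field_simp
  rw [e]
  have h3 : (ww x ^ 3 - 1) / (ww x ^ 4 - 1) ≤ 1 := by
    rw [div_le_one hd]
    have : ww x ^ 3 ≤ ww x ^ 4 := pow_le_pow_right₀ hw1 (by norm_num)
    linarith
  have : 0 ≤ x / ww x ^ 5 / 3 := by positivity
  nlinarith

lemma ll_le {x : ℝ} (hx : 0 < x) : ll x ≤ 1 / (2 * x) := by
  have h4 := ww4_gt hx
  have hw := ww_pos x
  have hw1 := ww_gt hx
  have hd : 0 < ww x ^ 4 - 1 := by linarith
  have h2 := ww_sq x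
  unfold ll
  rw [div_le_div_iff₀ (by positivity) (by positivity)]
  have e4 : ww x ^ 4 = (1 + x ^ 2 / 3) ^ 2 := by rw [← h2]; ring
  rw [e4, h2]
  nlinarith [pow_pos hx 2, pow_pos hx 4, pow_pos hx 6]

lemma kern_half (R : ℝ) (hR : 1 ≤ R) : ∃ C : ℝ, 0 < C ∧ ∀ y l : ℝ, l ≠ 0 →
    ‖∫ x in (0 : ℝ)..R, Complex.exp (Complex.I * ((y * x + l * x / ww x : ℝ) : ℂ)) *
      ((Real.sqrt x : ℝ) : ℂ)‖ ≤ C / Real.sqrt |l| := by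
  have hR0 : 0 < R := by linarith
  set c : ℝ := 2 / 3 / ww R ^ 5 with hc
  have hc0 : 0 < c := by have := ww_pos R; positivity
  set B : ℝ := Real.sqrt R / aa R with hB
  have hB0 : 0 < B := div_pos (Real.sqrt_pos.mpr hR0) (aa_pos hR0)
  refine ⟨1 + (2 + (1 / c + 1) * π) * B, by positivity, fun y l hl => ?_⟩
  set s := Real.sqrt |l| with hs
  have hs0 : 0 < s := Real.sqrt_pos.mpr (abs_pos.mpr hl)
  set δ : ℝ := min 1 (1 / s) with hδ
  have hδ0 : 0 < δ := lt_min one_pos (by positivity)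
  have hδ1 : δ ≤ 1 := min_le_left _ _
  have hδR : δ ≤ R := hδ1.trans hR
  have hφd : ∀ x, HasDerivAt (fun x => y * x + l * x / ww x) (y + l / ww x ^ 3) x := by
    intro x
    have hw := ww_pos x
    have h := ((hasDerivAt_id x).const_mul y).add
      (((hasDerivAt_id x).const_mul l).div (ww_deriv x) hw.ne')
    refine h.congr_deriv ?_
    have h2 := ww_sq x
    simp only [id]
    field_simp
    rw [h2]; ring
  have hcont : Continuous (fun x : ℝ => Complex.exp (Complex.I * ((y * x + l * x / ww x : ℝ) : ℂ)) *
      ((Real.sqrt x : ℝ) : ℂ)) := by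
    have : Continuous (fun x => y * x + l * x / ww x) :=
      continuous_iff_continuousAt.mpr fun x => (hφd x).continuousAt
    have h2 := Real.continuous_sqrt
    fun_prop
  rw [← intervalIntegral.integral_add_adjacent_intervals (b := δ) (hcont.intervalIntegrable _ _)
    (hcont.intervalIntegrable _ _)]
  have p1 : ‖∫ x in (0 : ℝ)..δ, Complex.exp (Complex.I * ((y * x + l * x / ww x : ℝ) : ℂ)) *
      ((Real.sqrt x : ℝ) : ℂ)‖ ≤ 1 / s := by
    have := intervalIntegral.norm_integral_le_of_norm_le_const (a := 0) (b := δ) (C := 1)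
      (f := fun x : ℝ => Complex.exp (Complex.I * ((y * x + l * x / ww x : ℝ) : ℂ)) *
      ((Real.sqrt x : ℝ) : ℂ)) (by
        intro x hx
        rw [Set.uIoc_of_le hδ0.le] at hx
        rw [norm_mul, mul_comm Complex.I, Complex.norm_exp_ofReal_mul_I, one_mul, Complex.norm_real,
          Real.norm_eq_abs, abs_of_nonneg (Real.sqrt_nonneg _)]
        exact Real.sqrt_le_one.mpr (hx.2.trans hδ1))
    refine this.trans ?_
    rw [sub_zero, abs_of_pos hδ0, one_mul]
    exact min_le_right _ _
  have hbd : ∀ x, 0 < x → HasDerivAt (fun x => Real.sqrt x / aa x)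
      (Real.sqrt x / aa x * (1 / (2 * x) - ll x)) x := by
    intro x hx
    have ha := aa_pos hx
    have h := (Real.hasDerivAt_sqrt hx.ne').div (aa_deriv hx) ha.ne'
    refine h.congr_deriv ?_
    have hsx := Real.sqrt_pos.mpr hx
    have hsx2 := Real.sq_sqrt hx.le
    have e : 1 / (2 * Real.sqrt x) = Real.sqrt x * (1 / (2 * x)) := by
      nth_rewrite 3 [← hsx2]
      field_simp
    rw [e]
    field_simp
  have hb'0 : ∀ x, 0 < x → 0 ≤ Real.sqrt x / aa x * (1 / (2 * x) - ll x) := by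
    intro x hx
    have ha := aa_pos hx
    exact mul_nonneg (by positivity) (sub_nonneg.mpr (ll_le hx))
  have hgd : ∀ x, HasDerivAt (fun x => 1 - 1 / ww x ^ 3) (x / ww x ^ 5) x := by
    intro x
    have hw := ww_pos x
    have := (((ww_deriv x).pow 3).inv (pow_pos hw 3).ne').const_sub 1
    have h := this.congr_deriv (g' := x / ww x ^ 5) (by
      simp only [Pi.pow_apply]
      field_simp
      push_cast
      ring)
    refine h.congr_of_eventuallyEq (Filter.Eventually.of_forall fun z => ?_)
    simp [one_div]
  have hqd : ∀ A D x : ℝ, 0 < x → HasDerivAt (fun x => (A + D * (1 - 1 / ww x ^ 3)) / aa x)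
      ((D * (x / ww x ^ 5 - (1 - 1 / ww x ^ 3) * ll x) - A * ll x) / aa x) x := by
    intro A D x hx
    have ha := aa_pos hx
    have h := (((hgd x).const_mul D).const_add A).div (aa_deriv hx) ha.ne'
    refine h.congr_deriv ?_
    field_simp
    ring
  have hg0 : ∀ x, 0 ≤ 1 - 1 / ww x ^ 3 := by
    intro x
    have : 1 / ww x ^ 3 ≤ 1 := by
      rw [div_le_one (pow_pos (ww_pos x) 3)]
      exact one_le_pow₀ (ww_ge x)
    linarith
  have p2 := vdc_abs hδR (fun x => y * x + l * x / ww x) aa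
    (fun x => ((y + l) + (-l) * (1 - 1 / ww x ^ 3)) / aa x)
    (fun x => ((-l) * (x / ww x ^ 5 - (1 - 1 / ww x ^ 3) * ll x) - (y + l) * ll x) / aa x)
    (fun x => ((-|y + l|) + |l| * (1 - 1 / ww x ^ 3)) / aa x)
    (fun x => (|l| * (x / ww x ^ 5 - (1 - 1 / ww x ^ 3) * ll x) - (-|y + l|) * ll x) / aa x)
    (fun x => Real.sqrt x / aa x) (fun x => Real.sqrt x / aa x * (1 / (2 * x) - ll x))
    (s := s) (c := c) (Λ := |l|) (B := B) hs0 hc0 (abs_pos.mpr hl) (Real.sq_sqrt (abs_nonneg l))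
    (by
      intro x hx
      have ha := aa_pos (hδ0.trans_le hx.1)
      refine (hφd x).congr_deriv ?_
      field_simp
      ring)
    (fun x hx => hqd _ _ x (hδ0.trans_le hx.1))
    (fun x hx => hqd _ _ x (hδ0.trans_le hx.1))
    (fun x hx => hbd x (hδ0.trans_le hx.1))
    (fun x hx => (aa_deriv (hδ0.trans_le hx.1)).continuousAt.continuousWithinAt)
    (fun x hx => (aa_pos (hδ0.trans_le hx.1)).le)
    (by
      intro x hx
      have ha := aa_pos (hδ0.trans_le hx.1)
      rw [abs_div, abs_div]
      refine div_le_div_of_nonneg_right ?_ (abs_nonneg _)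
      have h1 := abs_abs_sub_abs_le_abs_sub (y + l) (l * (1 - 1 / ww x ^ 3))
      rw [abs_mul l, abs_of_nonneg (hg0 x)] at h1
      calc _ = |(|y + l| - |l| * (1 - 1 / ww x ^ 3))| := by rw [← abs_neg]; congr 1; ring
        _ ≤ _ := h1
        _ = _ := by congr 1; ring)
    (by
      intro x hx
      have hx0 := hδ0.trans_le hx.1
      have ha := aa_pos hx0
      rw [abs_div, abs_of_pos ha]
      gcongr
      have hl0 := ll_pos hx0
      have hgl := gl_le hx0
      have hxx : 0 ≤ x / ww x ^ 5 := div_nonneg hx0.le (pow_pos (ww_pos x) 5).le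
      have hk : 0 ≤ x / ww x ^ 5 - (1 - 1 / ww x ^ 3) * ll x := by linarith
      refine (abs_sub _ _).trans ?_
      rw [abs_mul, abs_mul, abs_neg, abs_of_nonneg hk, abs_of_pos hl0]
      linarith)
    (by
      intro x hx
      have hx0 := hδ0.trans_le hx.1
      have ha := aa_pos hx0
      rw [le_div_iff₀ ha]
      have hl0 := ll_pos hx0
      have hgl := gl_le hx0
      have hm := ww_mono hx0.le hx.2
      have h5 : x * (2 / 3 / ww R ^ 5) ≤ 2 / 3 * (x / ww x ^ 5) := by
        have hw := ww_pos x
        have : x * (2 / 3 / ww R ^ 5) ≤ x * (2 / 3 / ww x ^ 5) := by gcongr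
        calc _ ≤ _ := this
          _ = _ := by ring
      have h6 : c * aa x ^ 2 ≤ x / ww x ^ 5 - (1 - 1 / ww x ^ 3) * ll x := by
        have := mul_le_mul_of_nonneg_left (aa_sq_le hx0) hc0.le
        rw [hc] at this ⊢
        linarith
      have h7 := mul_le_mul_of_nonneg_left h6 (abs_nonneg l)
      have h8 : 0 ≤ |y + l| * ll x := by positivity
      nlinarith)
    (fun x hx => div_nonneg (Real.sqrt_nonneg _) (aa_pos (hδ0.trans_le hx.1)).le)
    (by
      intro x hx
      have hmono : MonotoneOn (fun x => Real.sqrt x / aa x) (Set.Icc δ R) := by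
        apply monotoneOn_of_deriv_nonneg (convex_Icc _ _)
        · exact fun z hz => (hbd z (hδ0.trans_le hz.1)).continuousAt.continuousWithinAt
        · exact fun z hz => (hbd z (hδ0.trans_le
            (interior_subset hz).1)).differentiableAt.differentiableWithinAt
        · intro z hz
          have hz0 := hδ0.trans_le (interior_subset hz).1
          rw [(hbd z hz0).deriv]
          exact hb'0 z hz0
      exact hmono hx ⟨hδR, le_rfl⟩ hx.2)
    (fun x hx => hb'0 x (hδ0.trans_le hx.1))
  have e2 : (∫ x in δ..R, Complex.exp (Complex.I * ((y * x + l * x / ww x : ℝ) : ℂ)) *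
      ((aa x * (Real.sqrt x / aa x) : ℝ) : ℂ)) =
      ∫ x in δ..R, Complex.exp (Complex.I * ((y * x + l * x / ww x : ℝ) : ℂ)) *
      ((Real.sqrt x : ℝ) : ℂ) := by
    apply intervalIntegral.integral_congr
    intro x hx
    rw [Set.uIcc_of_le hδR] at hx
    have ha := aa_pos (hδ0.trans_le hx.1)
    simp only
    rw [mul_div_cancel₀ _ ha.ne']
  rw [e2] at p2
  refine (norm_add_le _ _).trans ((add_le_add p1 p2).trans_eq ?_)
  ring

open scoped FourierTransform in
lemma ft1_eq (f : SchwartzMap ℝ ℂ) (ξ : ℝ) :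
    ft1 f ξ = (((2 * π) ^ (-(1 : ℝ) / 2) : ℝ) : ℂ) * (𝓕 f) (ξ / (2 * π)) := by
  rw [ft1, SchwartzMap.fourier_coe, Real.fourier_real_eq_integral_exp_smul]
  congr 1
  apply integral_congr_ae
  refine Filter.Eventually.of_forall fun x => ?_
  simp only [smul_eq_mul]
  congr 2
  have : (π : ℂ) ≠ 0 := by exact_mod_cast Real.pi_ne_zero
  push_cast
  field_simp

lemma c0_sq : (((2 * π) ^ (-(1 : ℝ) / 2) : ℝ) : ℂ) * (((2 * π) ^ (-(1 : ℝ) / 2) : ℝ) : ℂ) * (2 * π : ℝ)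
    = 1 := by
  rw [← Complex.ofReal_mul, ← Complex.ofReal_mul, ← Real.rpow_add (by positivity)]
  norm_num
  rw [Real.rpow_neg_one]
  have : (π : ℂ) ≠ 0 := by exact_mod_cast Real.pi_ne_zero
  push_cast
  field_simp

open scoped FourierTransform in
lemma inv_lemma (u : ℝ → ℂ) (hu : ContDiff ℝ (⊤ : ℕ∞) u) (huc : HasCompactSupport u) (g : ℝ → ℂ)
    (hg : ∀ x, g x = (((2 * π) ^ (-(1 : ℝ) / 2) : ℝ) : ℂ) *
      ∫ ξ : ℝ, Complex.exp (Complex.I * (x * ξ : ℝ)) * u ξ) :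
    Integrable g ∧ ∀ ξ, ft1 g ξ = u ξ := by
  have hpi : (π : ℂ) ≠ 0 := by exact_mod_cast Real.pi_ne_zero
  set U : SchwartzMap ℝ ℂ := huc.toSchwartzMap hu with hU
  have hUu : ∀ x, U x = u x := fun x => rfl
  have hgV : g = fun x => (((2 * π) ^ (-(1 : ℝ) / 2) : ℝ) : ℂ) * (𝓕⁻ U) (x / (2 * π)) := by
    funext x
    rw [hg, SchwartzMap.fourierInv_coe, Real.fourierInv_eq']
    congr 1
    apply integral_congr_ae
    refine Filter.Eventually.of_forall fun z => ?_
    simp only [smul_eq_mul, hUu]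
    congr 2
    simp only [RCLike.inner_apply, conj_trivial]
    push_cast
    field_simp
  constructor
  · rw [hgV]
    exact ((𝓕⁻ U).integrable.comp_div (by positivity : (2 * π) ≠ 0)).const_mul _
  · intro ξ
    rw [ft1]
    set V : SchwartzMap ℝ ℂ := 𝓕⁻ U with hV
    obtain ⟨W, hW⟩ : ∃ W : ℝ → ℂ, W = fun v : ℝ => (((2 * π) ^ (-(1 : ℝ) / 2) : ℝ) : ℂ) *
          (Complex.exp (((-2 * π * v * ξ : ℝ) : ℂ) * Complex.I) * V v) := ⟨_, rfl⟩
    have e : (∫ x : ℝ, Complex.exp (-Complex.I * (x * ξ : ℝ)) * g x) =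
        ∫ x : ℝ, W (x / (2 * π)) := by
      apply integral_congr_ae
      refine Filter.Eventually.of_forall fun z => ?_
      simp only [hgV, hW]
      rw [mul_left_comm]
      congr 3
      push_cast
      field_simp
    rw [e, Measure.integral_comp_div W (2 * π), hW, integral_const_mul]
    have h2 : (∫ v : ℝ, Complex.exp (((-2 * π * v * ξ : ℝ) : ℂ) * Complex.I) * V v) = u ξ := by
      have h3 := Real.fourier_real_eq_integral_exp_smul (⇑V) ξ
      simp only [smul_eq_mul] at h3
      rw [← h3, ← SchwartzMap.fourier_coe, hV, FourierTransform.fourier_fourierInv_eq, hUu]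
    rw [h2, abs_of_pos (by positivity), Complex.real_smul]
    calc _ = ((((2 * π) ^ (-(1 : ℝ) / 2) : ℝ) : ℂ) * (((2 * π) ^ (-(1 : ℝ) / 2) : ℝ) : ℂ) *
        (2 * π : ℝ)) * u ξ := by ring
      _ = _ := by rw [c0_sq, one_mul]

lemma ft1_contDiff (f : SchwartzMap ℝ ℂ) : ContDiff ℝ (⊤ : ℕ∞) (ft1 f) := by
  have : ft1 f = fun ξ => (((2 * π) ^ (-(1 : ℝ) / 2) : ℝ) : ℂ) *
      (FourierTransform.fourier f) (ξ / (2 * π)) := funext fun ξ => ft1_eq f ξ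
  rw [this]
  have h := (FourierTransform.fourier f).smooth (⊤ : ℕ∞)
  exact contDiff_const.mul (h.comp (contDiff_id.div_const _))

lemma chi_contDiff (χ : ℝ → ℝ) (hχ : ContDiff ℝ (⊤ : ℕ∞) χ)
    (hχ1 : ∀ᶠ y in nhds (0 : ℝ), χ y = 1) (m : ℝ) :
    ContDiff ℝ (⊤ : ℕ∞) (fun ξ => χ (m * |ξ|)) := by
  rw [contDiff_iff_contDiffAt]
  intro x
  by_cases hx : x = 0
  · subst hx
    have h : Filter.Tendsto (fun ξ : ℝ => m * |ξ|) (nhds 0) (nhds 0) := by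
      have : Continuous (fun ξ : ℝ => m * |ξ|) := by fun_prop
      have := this.tendsto 0
      simpa using this
    exact (contDiffAt_const (c := (1 : ℝ))).congr_of_eventuallyEq (h.eventually hχ1)
  · exact hχ.contDiffAt.comp x (contDiffAt_const.mul (contDiffAt_abs hx))

lemma sign_meas : Measurable Real.sign := by
  unfold Real.sign
  exact Measurable.ite measurableSet_Iio measurable_const
    (Measurable.ite measurableSet_Ioi measurable_const measurable_const)

lemma sign_le (x : ℝ) : |Real.sign x| ≤ 1 := by
  rcases Real.sign_apply_eq x with h | h | h <;> rw [h] <;> norm_num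

/-- truncated kernel symbol -/
noncomputable def kk (R σ τ μ : ℝ) : ℝ → ℂ :=
  Set.indicator {ξ : ℝ | |Real.sqrt μ * ξ| ≤ R} fun ξ =>
    prop1 σ τ μ ξ * ((Real.sign ξ * Real.sqrt |ξ| : ℝ) : ℂ)

lemma kk_integrable (R σ τ μ : ℝ) (hμ : 0 < μ) : Integrable (kk R σ τ μ) := by
  have hm : 0 < Real.sqrt μ := Real.sqrt_pos.mpr hμ
  have hset : {ξ : ℝ | |Real.sqrt μ * ξ| ≤ R} = Set.Icc (-(R / Real.sqrt μ)) (R / Real.sqrt μ) := by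
    ext ξ
    rw [Set.mem_ofPred_eq, abs_mul, abs_of_pos hm, Set.mem_Icc, ← abs_le, le_div_iff₀ hm, mul_comm]
  unfold kk
  rw [hset]
  rw [integrable_indicator_iff measurableSet_Icc]
  refine Measure.integrableOn_of_bounded (M := Real.sqrt (R / Real.sqrt μ))
    (by simp) ?_ ?_
  · apply Measurable.aestronglyMeasurable
    have h1 : Measurable (prop1 σ τ μ) := by
      unfold prop1
      fun_prop
    have h2 := sign_meas
    fun_prop
  · refine (ae_restrict_iff' measurableSet_Icc).mpr (Filter.Eventually.of_forall fun ξ hξ => ?_)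
    rw [norm_mul, prop1, mul_comm Complex.I, Complex.norm_exp_ofReal_mul_I, one_mul,
      Complex.norm_real, Real.norm_eq_abs, abs_mul, abs_of_nonneg (Real.sqrt_nonneg _)]
    have h1 := sign_le ξ
    have h2 : Real.sqrt |ξ| ≤ Real.sqrt (R / Real.sqrt μ) := Real.sqrt_le_sqrt (abs_le.mpr hξ)
    have h3 := Real.sqrt_nonneg |ξ|
    nlinarith [abs_nonneg (Real.sign ξ)]

lemma kern_full (R : ℝ) (hR : 1 ≤ R) : ∃ C : ℝ, 0 < C ∧ ∀ σ τ μ x : ℝ, (σ = 1 ∨ σ = -1) → τ ≠ 0 →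
    0 < μ → ‖∫ ξ : ℝ, Complex.exp (Complex.I * (x * ξ : ℝ)) * kk R σ τ μ ξ‖ ≤
      C * (1 / Real.sqrt μ) * (1 / Real.sqrt |τ|) := by
  obtain ⟨C, hC, hK⟩ := kern_half R hR
  refine ⟨2 * C, by positivity, fun σ τ μ x hσ hτ hμ => ?_⟩
  have hR0 : 0 < R := by linarith
  set m := Real.sqrt μ with hmdef
  have hm : 0 < m := Real.sqrt_pos.mpr hμ
  have hm2 : m ^ 2 = μ := Real.sq_sqrt hμ.le
  have hσ1 : |σ| = 1 := by rcases hσ with h | h <;> rw [h] <;> norm_num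
  have hσ0 : σ ≠ 0 := by rcases hσ with h | h <;> rw [h] <;> norm_num
  set y := x / m with hy
  set l := σ * τ / m with hl
  have hl0 : l ≠ 0 := div_ne_zero (mul_ne_zero hσ0 hτ) hm.ne'
  have hlabs : |l| = |τ| / m := by rw [hl, abs_div, abs_mul, hσ1, one_mul, abs_of_pos hm]
  set G : ℝ → ℂ := fun η => Complex.exp (Complex.I * ((y * η + l * η / ww η : ℝ) : ℂ)) *
    ((Real.sign η * Real.sqrt |η| : ℝ) : ℂ) with hG
  set F : ℝ → ℂ := Set.indicator (Set.Icc (-R) R) G with hF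
  have e1 : ∀ ξ : ℝ, Complex.exp (Complex.I * (x * ξ : ℝ)) * kk R σ τ μ ξ =
      ((1 / Real.sqrt m : ℝ) : ℂ) * F (m * ξ) := by
    intro ξ
    by_cases h : |m * ξ| ≤ R
    · have h1 : kk R σ τ μ ξ = prop1 σ τ μ ξ * ((Real.sign ξ * Real.sqrt |ξ| : ℝ) : ℂ) :=
        Set.indicator_of_mem (s := {ξ : ℝ | |Real.sqrt μ * ξ| ≤ R}) h _
      have h2 : F (m * ξ) = G (m * ξ) := Set.indicator_of_mem (s := Set.Icc (-R) R) (Set.mem_Icc.mpr (abs_le.mp h)) G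
      rw [h1, h2, prop1, hG]
      have hw : Real.sqrt (1 + μ * ξ ^ 2 / 3) = ww (m * ξ) := by
        rw [ww, mul_pow, hm2]
      have hsg : Real.sign (m * ξ) = Real.sign ξ := by
        rcases lt_trichotomy ξ 0 with h0 | h0 | h0
        · rw [Real.sign_of_neg h0, Real.sign_of_neg (mul_neg_of_pos_of_neg hm h0)]
        · simp [h0]
        · rw [Real.sign_of_pos h0, Real.sign_of_pos (mul_pos hm h0)]
      have hsq : Real.sqrt |m * ξ| = Real.sqrt m * Real.sqrt |ξ| := by
        rw [abs_mul, abs_of_pos hm, Real.sqrt_mul hm.le]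
      simp only [hsg, hsq, hw]
      have hp : y * (m * ξ) + l * (m * ξ) / ww (m * ξ) = x * ξ + σ * τ * ξ / ww (m * ξ) := by
        rw [hy, hl]
        have := (ww_pos (m * ξ)).ne'
        field_simp
      rw [hp, Complex.ofReal_add, mul_add, Complex.exp_add]
      have hsm : ((Real.sqrt m : ℝ) : ℂ) ≠ 0 := by
        exact_mod_cast (Real.sqrt_pos.mpr hm).ne'
      push_cast
      field_simp
    · have h1 : kk R σ τ μ ξ = 0 :=
        Set.indicator_of_notMem (s := {ξ : ℝ | |Real.sqrt μ * ξ| ≤ R}) h _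
      have h2 : F (m * ξ) = 0 := Set.indicator_of_notMem (s := Set.Icc (-R) R) (fun h' => h (abs_le.mpr h')) G
      rw [h1, h2]; simp
  have e2 : (∫ η, F η) = (∫ η in (-R)..0, G η) + ∫ η in (0:ℝ)..R, G η := by
    have hint : Integrable F := by
      have hi := kk_integrable R 1 l 1 one_pos
      have hi2 := hi.bdd_mul (c := 1) (f := fun η : ℝ => Complex.exp (Complex.I * ((y * η : ℝ) : ℂ)))
        (by
          apply Continuous.aestronglyMeasurable
          fun_prop)
        (Filter.Eventually.of_forall fun z => by
          rw [mul_comm Complex.I, Complex.norm_exp_ofReal_mul_I])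
      refine hi2.congr (Filter.Eventually.of_forall fun z => ?_)
      simp only [kk, hF, Real.sqrt_one, one_mul]
      have hs : {ξ : ℝ | |ξ| ≤ R} = Set.Icc (-R) R := by ext; simp [abs_le]
      rw [hs]
      by_cases hz : z ∈ Set.Icc (-R) R
      · rw [Set.indicator_of_mem hz, Set.indicator_of_mem hz, hG, prop1]
        simp only [ww, one_mul]
        rw [← mul_assoc, ← Complex.exp_add, ← mul_add, ← Complex.ofReal_add]
      · rw [Set.indicator_of_notMem hz, Set.indicator_of_notMem hz, mul_zero]
    have hGi : IntegrableOn G (Set.Icc (-R) R) := (integrable_indicator_iff measurableSet_Icc).mp hint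
    rw [hF, integral_indicator measurableSet_Icc, integral_Icc_eq_integral_Ioc,
      ← intervalIntegral.integral_of_le (by linarith), intervalIntegral.integral_add_adjacent_intervals]
    · rw [intervalIntegrable_iff_integrableOn_Icc_of_le (by linarith)]
      exact hGi.mono_set (Set.Icc_subset_Icc_right hR0.le)
    · rw [intervalIntegrable_iff_integrableOn_Icc_of_le (by linarith)]
      exact hGi.mono_set (Set.Icc_subset_Icc_left (by linarith))
  have e3 : (∫ η in (0:ℝ)..R, G η) = ∫ η in (0 : ℝ)..R,
      Complex.exp (Complex.I * ((y * η + l * η / ww η : ℝ) : ℂ)) * ((Real.sqrt η : ℝ) : ℂ) := by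
    apply intervalIntegral.integral_congr
    intro η hη
    rw [Set.uIcc_of_le hR0.le] at hη
    simp only [hG]
    rcases hη.1.eq_or_lt with h | h
    · rw [← h]; simp
    · rw [Real.sign_of_pos h, abs_of_pos h, one_mul]
  have e4 : (∫ η in (-R)..0, G η) = -∫ η in (0 : ℝ)..R,
      Complex.exp (Complex.I * (((-y) * η + (-l) * η / ww η : ℝ) : ℂ)) * ((Real.sqrt η : ℝ) : ℂ) := by
    have := intervalIntegral.integral_comp_neg (a := 0) (b := R) G
    rw [neg_zero] at this
    rw [← this, ← intervalIntegral.integral_neg]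
    apply intervalIntegral.integral_congr
    intro η hη
    rw [Set.uIcc_of_le hR0.le] at hη
    simp only [hG]
    rcases hη.1.eq_or_lt with h | h
    · rw [← h]; simp
    · have hw : ww (-η) = ww η := by simp [ww]
      rw [Real.sign_of_neg (by linarith : -η < 0), abs_neg, abs_of_pos h, hw]
      have : y * -η + l * -η / ww η = -y * η + -l * η / ww η := by ring
      rw [this]
      push_cast
      ring
  have hbound : ‖∫ η, F η‖ ≤ 2 * C / Real.sqrt |l| := by
    rw [e2, e3, e4]
    refine (norm_add_le _ _).trans ?_
    rw [norm_neg]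
    have h1 := hK y l hl0
    have h2 := hK (-y) (-l) (neg_ne_zero.mpr hl0)
    rw [abs_neg] at h2
    calc _ ≤ C / Real.sqrt |l| + C / Real.sqrt |l| := add_le_add h2 h1
      _ = _ := by ring
  have hτ' : 0 < |τ| := abs_pos.mpr hτ
  rw [integral_congr_ae (Filter.Eventually.of_forall e1), integral_const_mul,
    Measure.integral_comp_mul_left, norm_mul, norm_smul, Complex.norm_real, Real.norm_eq_abs,
    Real.norm_eq_abs, abs_abs, abs_of_pos (by positivity : 0 < 1 / Real.sqrt m),
    abs_of_pos (by positivity : 0 < m⁻¹)]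
  have hsm := Real.sqrt_pos.mpr hm
  have hsτ := Real.sqrt_pos.mpr hτ'
  calc 1 / Real.sqrt m * (m⁻¹ * ‖∫ η, F η‖) ≤ 1 / Real.sqrt m * (m⁻¹ * (2 * C / Real.sqrt |l|)) := by
        gcongr
    _ = _ := by
      rw [hlabs, Real.sqrt_div hτ'.le]
      field_simp

lemma conv_bound (k g : ℝ → ℂ) (hk : Integrable k) (hg : Integrable g) (K : ℝ) (x : ℝ)
    (hK : ∀ z : ℝ, ‖∫ ξ : ℝ, Complex.exp (Complex.I * (z * ξ : ℝ)) * k ξ‖ ≤ K) :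
    ‖∫ ξ : ℝ, Complex.exp (Complex.I * (x * ξ : ℝ)) * k ξ *
      ∫ y : ℝ, Complex.exp (-Complex.I * (y * ξ : ℝ)) * g y‖ ≤ K * ∫ y, ‖g y‖ := by
  have hprod : Integrable (Function.uncurry fun ξ y : ℝ =>
      Complex.exp (Complex.I * ((x - y) * ξ : ℝ)) * (k ξ * g y)) (volume.prod volume) := by
    refine (hk.mul_prod hg).bdd_mul (c := 1)
      (f := fun p : ℝ × ℝ => Complex.exp (Complex.I * ((x - p.2) * p.1 : ℝ))) ?_ ?_
    · apply Continuous.aestronglyMeasurable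
      fun_prop
    · refine Filter.Eventually.of_forall fun z => ?_
      rw [mul_comm Complex.I, Complex.norm_exp_ofReal_mul_I]
  have e : (∫ ξ : ℝ, Complex.exp (Complex.I * (x * ξ : ℝ)) * k ξ *
      ∫ y : ℝ, Complex.exp (-Complex.I * (y * ξ : ℝ)) * g y) =
      ∫ y : ℝ, (∫ ξ : ℝ, Complex.exp (Complex.I * ((x - y) * ξ : ℝ)) * k ξ) * g y := by
    have h := integral_integral_swap hprod
    calc _ = ∫ ξ : ℝ, ∫ y : ℝ, Complex.exp (Complex.I * ((x - y) * ξ : ℝ)) * (k ξ * g y) := by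
          congr 1
          funext ξ
          rw [← integral_const_mul]
          congr 1
          funext y
          have : Complex.exp (Complex.I * ((x - y) * ξ : ℝ)) =
              Complex.exp (Complex.I * (x * ξ : ℝ)) * Complex.exp (-Complex.I * (y * ξ : ℝ)) := by
            rw [← Complex.exp_add]
            congr 1
            push_cast
            ring
          rw [this]
          ring
      _ = _ := h
      _ = _ := by
          congr 1
          funext y
          rw [← integral_mul_const]
          congr 1
          funext ξ
          ring
  rw [e, ← integral_const_mul]
  refine norm_integral_le_of_norm_le (hg.norm.const_mul K) (Filter.Eventually.of_forall fun y => ?_)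
  rw [norm_mul]
  exact mul_le_mul_of_nonneg_right (hK (x - y)) (norm_nonneg _)

/-- Low-frequency dispersive decay for the 1D Boussinesq propagator:
`‖e^{±(t/ε)∂ₓ/√(1+μD²/3)} χ(√μ|D|) sgn(D) |D|^{1/2} f‖_{L^∞} ≤ C μ^{-1/2} (ε/|t|)^{1/2}
‖χ(√μ|D|) f‖_{L¹}`. -/
theorem stmt10 (χ : ℝ → ℝ) (hχ : ContDiff ℝ (⊤ : ℕ∞) χ) (hχc : HasCompactSupport χ)
    (hχ1 : ∀ᶠ y in nhds (0 : ℝ), χ y = 1) (σ : ℝ) (hσ : σ = 1 ∨ σ = -1) :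
    ∃ C : ℝ, 0 < C ∧ ∀ f : SchwartzMap ℝ ℂ, ∀ t : ℝ, t ≠ 0 →
      ∀ μ ∈ Set.Ioc (0 : ℝ) 1, ∀ ε ∈ Set.Ioc (0 : ℝ) 1,
        eLpNorm
          (fmult1 (fun ξ => prop1 σ (t / ε) μ ξ * ((χ (Real.sqrt μ * |ξ|) : ℝ) : ℂ) *
            ((Real.sign ξ : ℝ) : ℂ) * ((|ξ| ^ ((1 : ℝ) / 2) : ℝ) : ℂ)) ⇑f) ⊤ volume ≤
          ENNReal.ofReal (C * μ ^ (-(1 : ℝ) / 2) * (ε / |t|) ^ ((1 : ℝ) / 2)) *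
            eLpNorm (fmult1 (fun ξ => ((χ (Real.sqrt μ * |ξ|) : ℝ) : ℂ)) ⇑f) 1 volume := by
  obtain ⟨R₀, hR₀⟩ := (hχc.isCompact.isBounded).subset_closedBall (0 : ℝ)
  set R := max 1 R₀ with hRdef
  have hR : 1 ≤ R := le_max_left _ _
  have hχR : ∀ y : ℝ, R < |y| → χ y = 0 := by
    intro y hy
    by_contra hne
    have h1 := hR₀ (subset_tsupport χ (Function.mem_support.mpr hne))
    rw [mem_closedBall_zero_iff, Real.norm_eq_abs] at h1
    exact absurd (h1.trans (le_max_right 1 R₀)) (not_le.mpr hy)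
  obtain ⟨C, hC, hK⟩ := kern_full R hR
  set c₀ : ℝ := (2 * π) ^ (-(1 : ℝ) / 2) with hc₀
  have hc₀0 : 0 < c₀ := by positivity
  refine ⟨c₀ * c₀ * C, by positivity, fun f t ht μ hμ ε hε => ?_⟩
  have hμ0 := hμ.1
  have hε0 := hε.1
  have hm : 0 < Real.sqrt μ := Real.sqrt_pos.mpr hμ0
  set u : ℝ → ℂ := fun ξ => ((χ (Real.sqrt μ * |ξ|) : ℝ) : ℂ) * ft1 f ξ with hu
  set g : ℝ → ℂ := fmult1 (fun ξ => ((χ (Real.sqrt μ * |ξ|) : ℝ) : ℂ)) ⇑f with hg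
  have huzero : ∀ ξ : ℝ, R < |Real.sqrt μ * ξ| → u ξ = 0 := by
    intro ξ hξ
    have : χ (Real.sqrt μ * |ξ|) = 0 := by
      apply hχR
      rwa [abs_mul, abs_abs, ← abs_mul]
    simp [hu, this]
  have husm : ContDiff ℝ (⊤ : ℕ∞) u :=
    (Complex.ofRealCLM.contDiff.comp (chi_contDiff χ hχ hχ1 (Real.sqrt μ))).mul (ft1_contDiff f)
  have hucs : HasCompactSupport u := by
    apply HasCompactSupport.of_support_subset_isCompact
      (isCompact_Icc (a := -(R / Real.sqrt μ)) (b := R / Real.sqrt μ))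
    intro ξ hξ
    by_contra hne
    apply hξ
    apply huzero
    rw [Set.mem_Icc, ← abs_le, not_le, div_lt_iff₀ hm] at hne
    rwa [abs_mul, abs_of_pos hm, mul_comm]
  obtain ⟨hgi, hgu⟩ := inv_lemma u husm hucs g (by
    intro x
    simp only [hg, fmult1, hu, mul_assoc])
  have hτ : t / ε ≠ 0 := div_ne_zero ht hε0.ne'
  have hbound : ∀ x, ‖fmult1 (fun ξ => prop1 σ (t / ε) μ ξ * ((χ (Real.sqrt μ * |ξ|) : ℝ) : ℂ) *
            ((Real.sign ξ : ℝ) : ℂ) * ((|ξ| ^ ((1 : ℝ) / 2) : ℝ) : ℂ)) ⇑f x‖ ≤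
      c₀ * c₀ * (C * (1 / Real.sqrt μ) * (1 / Real.sqrt |t / ε|)) * ∫ y, ‖g y‖ := by
    intro x
    have e : fmult1 (fun ξ => prop1 σ (t / ε) μ ξ * ((χ (Real.sqrt μ * |ξ|) : ℝ) : ℂ) *
            ((Real.sign ξ : ℝ) : ℂ) * ((|ξ| ^ ((1 : ℝ) / 2) : ℝ) : ℂ)) ⇑f x =
        (c₀ : ℂ) * ((c₀ : ℂ) * ∫ ξ : ℝ, Complex.exp (Complex.I * (x * ξ : ℝ)) * kk R σ (t / ε) μ ξ *
      ∫ y : ℝ, Complex.exp (-Complex.I * (y * ξ : ℝ)) * g y) := by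
      rw [fmult1]
      congr 1
      rw [← integral_const_mul]
      congr 1
      funext ξ
      have h1 : (c₀ : ℂ) * (∫ y : ℝ, Complex.exp (-Complex.I * (y * ξ : ℝ)) * g y) = u ξ := hgu ξ
      rw [mul_left_comm (c₀ : ℂ), h1, ← Real.sqrt_eq_rpow]
      by_cases h : |Real.sqrt μ * ξ| ≤ R
      · have h2 : kk R σ (t / ε) μ ξ =
            prop1 σ (t / ε) μ ξ * ((Real.sign ξ * Real.sqrt |ξ| : ℝ) : ℂ) :=
          Set.indicator_of_mem (s := {ξ : ℝ | |Real.sqrt μ * ξ| ≤ R}) h _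
        rw [h2, hu]
        push_cast
        ring
      · have h3 := huzero ξ (not_le.mp h)
        rw [h3, mul_zero]
        calc _ = Complex.exp (Complex.I * (x * ξ : ℝ)) * prop1 σ (t / ε) μ ξ *
            ((Real.sign ξ : ℝ) : ℂ) * ((Real.sqrt |ξ| : ℝ) : ℂ) * u ξ := by rw [hu]; ring
          _ = 0 := by rw [h3, mul_zero]
    rw [e, norm_mul, norm_mul, Complex.norm_real, Real.norm_eq_abs, abs_of_pos hc₀0]
    have := conv_bound (kk R σ (t / ε) μ) g (kk_integrable _ _ _ _ hμ0) hgi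
      (C * (1 / Real.sqrt μ) * (1 / Real.sqrt |t / ε|)) x
      (fun z => hK σ (t / ε) μ z hσ hτ hμ0)
    calc _ ≤ c₀ * (c₀ * ((C * (1 / Real.sqrt μ) * (1 / Real.sqrt |t / ε|)) * ∫ y, ‖g y‖)) := by
          gcongr
      _ = _ := by ring
  have hconst : c₀ * c₀ * C * μ ^ (-(1 : ℝ) / 2) * (ε / |t|) ^ ((1 : ℝ) / 2) =
      c₀ * c₀ * (C * (1 / Real.sqrt μ) * (1 / Real.sqrt |t / ε|)) := by
    have h1 : μ ^ (-(1 : ℝ) / 2) = 1 / Real.sqrt μ := by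
      rw [neg_div, Real.rpow_neg hμ0.le, ← Real.sqrt_eq_rpow, one_div]
    have h2 : (ε / |t|) ^ ((1 : ℝ) / 2) = 1 / Real.sqrt |t / ε| := by
      rw [← Real.sqrt_eq_rpow, abs_div, abs_of_pos hε0, one_div, ← Real.sqrt_inv, inv_div]
    rw [h1, h2]; ring
  rw [hconst, eLpNorm_exponent_top, eLpNorm_one_eq_lintegral_enorm,
    ← ofReal_integral_norm_eq_lintegral_enorm hgi,
    ← ENNReal.ofReal_mul (by positivity)]
  exact eLpNormEssSup_le_of_ae_bound (Filter.Eventually.of_forall hbound)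
end

section
/- Let χ : ℝ → ℝ be a smooth compactly supported function that is equal to 1 in a neighbourhood of 0, and fix one of the two signs ±. There exists a constant C > 0 such that for every Schwartz function f on ℝ, every real t ≠ 0, every μ ∈ (0,1] and every ε ∈ (0,1], one has ‖e^{±(t/ε) ∂ₓ/√(1+μD²/3)} (1 − χ(√μ|D|)) f‖_{L^∞(ℝ)} ≤ C μ^{-1/2} (ε/|t|)^{1/2} ‖(1 − χ(√μ|D|)) (√μ|D|)² f‖_{L¹(ℝ)}. -/
open MeasureTheory Real Complex
open scoped ENNReal

noncomputable def bs (u : ℝ) : ℝ := Real.sqrt (u ^ 2 + 1 / 3)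
noncomputable def bb (u : ℝ) : ℝ := (u / bs u) ^ 3

lemma bs_pos (u : ℝ) : 0 < bs u := Real.sqrt_pos.mpr (by positivity)
lemma bs_sq (u : ℝ) : bs u ^ 2 = u ^ 2 + 1 / 3 := Real.sq_sqrt (by positivity)

lemma bs_deriv (u : ℝ) : HasDerivAt bs (u / bs u) u := by
  have h : HasDerivAt (fun u : ℝ => u ^ 2 + 1 / 3) (2 * u) u := by
    simpa using (hasDerivAt_pow 2 u).add_const (1 / 3 : ℝ)
  have := h.sqrt (by positivity)
  refine (show HasDerivAt bs _ u from this).congr_deriv ?_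
  have hp := bs_pos u
  change 2 * u / (2 * bs u) = _
  field_simp

lemma bb_deriv (u : ℝ) : HasDerivAt bb (u ^ 2 / bs u ^ 5) u := by
  have h := (((hasDerivAt_id u).div (bs_deriv u) (bs_pos u).ne').pow 3)
  have hp := bs_pos u
  have hs := bs_sq u
  refine (show HasDerivAt bb _ u from h).congr_deriv ?_
  have e : (1 * bs u - u * (u / bs u)) / bs u ^ 2 = (1 / 3) / bs u ^ 3 := by
    field_simp
    rw [hs]; ring
  simp only [Pi.div_apply, id]
  rw [e]
  push_cast
  field_simp

lemma bb_cont : Continuous bb := continuous_iff_continuousAt.2 fun u => (bb_deriv u).continuousAt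
lemma bs_cont : Continuous bs := continuous_iff_continuousAt.2 fun u => (bs_deriv u).continuousAt

noncomputable def mU (U : ℝ) : ℝ := 1 / (3 * bs U ^ 5)

lemma mU_pos (U : ℝ) : 0 < mU U := by have := bs_pos U; unfold mU; positivity

lemma bs_le {u v : ℝ} (hu : 0 ≤ u) (h : u ≤ v) : bs u ≤ bs v := by
  unfold bs; gcongr

lemma bb_mono {U : ℝ} : MonotoneOn (fun u => bb u - mU U * u ^ 3) (Set.Icc 0 U) := by
  apply monotoneOn_of_deriv_nonneg (convex_Icc 0 U)
  · exact (bb_cont.sub (by fun_prop)).continuousOn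
  · intro x _
    exact ((bb_deriv x).sub ((hasDerivAt_pow 3 x).const_mul (mU U))).differentiableAt.differentiableWithinAt
  · intro x hx
    rw [interior_Icc] at hx
    rw [(show HasDerivAt (fun u => bb u - mU U * u ^ 3) _ x from
      (bb_deriv x).sub ((hasDerivAt_pow 3 x).const_mul (mU U))).deriv]
    have h1 := bs_le hx.1.le hx.2.le
    have h0 := bs_pos x
    have h2 : 1 / bs U ^ 5 ≤ 1 / bs x ^ 5 := by gcongr
    have : mU U = 1 / bs U ^ 5 / 3 := by unfold mU; field_simp
    rw [this]
    push_cast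
    have : x ^ 2 / bs x ^ 5 - 1 / bs U ^ 5 / 3 * (3 * x ^ 2) = x ^ 2 * (1 / bs x ^ 5 - 1 / bs U ^ 5) := by ring
    rw [this]
    exact mul_nonneg (by positivity) (by linarith)

lemma bb_lower {U u v : ℝ} (hu : u ∈ Set.Icc 0 U) (hv : v ∈ Set.Icc 0 U) :
    mU U * (|u - v| * (u ^ 2 + u * v + v ^ 2)) ≤ |bb u - bb v| := by
  have hnn : 0 ≤ u ^ 2 + u * v + v ^ 2 := by have := hu.1; have := hv.1; positivity
  have hm := mU_pos U
  rcases le_total u v with h | h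
  · have := bb_mono hu hv h
    simp only at this
    rw [abs_of_nonpos (by linarith), abs_sub_comm]
    refine le_trans ?_ (le_abs_self _)
    nlinarith
  · have := bb_mono hv hu h
    simp only at this
    rw [abs_of_nonneg (by linarith)]
    refine le_trans ?_ (le_abs_self _)
    nlinarith

lemma exists_u0 {U : ℝ} (hU : 0 < U) (c : ℝ) : ∃ u0 ∈ Set.Icc 0 U, ∀ u ∈ Set.Icc 0 U,
    |bb u - bb u0| ≤ |bb u + c| := by
  have mono : MonotoneOn bb (Set.Icc 0 U) := by
    intro x hx y hy hxy
    have := bb_mono hx hy hxy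
    have h3 : x ^ 3 ≤ y ^ 3 := pow_le_pow_left₀ hx.1 hxy 3
    have hm := mU_pos U
    simp only at this
    nlinarith
  have h0 : (0 : ℝ) ∈ Set.Icc 0 U := ⟨le_rfl, hU.le⟩
  have h1 : U ∈ Set.Icc 0 U := ⟨hU.le, le_rfl⟩
  by_cases ha : -c ≤ bb 0
  · refine ⟨0, h0, fun u hu => ?_⟩
    have := mono h0 hu hu.1
    rw [abs_of_nonneg (by linarith), abs_of_nonneg (by linarith)]; linarith
  by_cases hb : bb U ≤ -c
  · refine ⟨U, h1, fun u hu => ?_⟩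
    have := mono hu h1 hu.2
    rw [abs_of_nonpos (by linarith), abs_of_nonpos (by linarith)]; linarith
  push Not at ha hb
  obtain ⟨u0, hu0, he⟩ := intermediate_value_Icc hU.le bb_cont.continuousOn ⟨ha.le, hb.le⟩
  exact ⟨u0, hu0, fun u hu => by rw [he, sub_neg_eq_add]⟩

noncomputable def ph (A B u : ℝ) : ℝ := A / u + B / bs u

noncomputable def Fe (A B u : ℝ) : ℂ := Complex.exp (Complex.I * (ph A B u : ℂ))

lemma Fe_norm (A B u : ℝ) : ‖Fe A B u‖ = 1 := by
  unfold Fe; rw [mul_comm]; exact Complex.norm_exp_ofReal_mul_I _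

lemma Fe_meas (A B : ℝ) : Measurable (Fe A B) := by
  have := bs_cont.measurable
  unfold Fe ph; fun_prop

lemma Fe_ii (A B a b : ℝ) : IntervalIntegrable (Fe A B) volume a b := by
  refine IntervalIntegrable.mono_fun (g := Fe A B) (f := fun _ => (1 : ℂ)) (by simp) (Fe_meas A B).aestronglyMeasurable ?_
  filter_upwards with x
  rw [Fe_norm]; simp

lemma ph_deriv {A B u : ℝ} (hB : B ≠ 0) (hu : 0 < u) :
    HasDerivAt (ph A B) (-(B * (bb u + A / B) / u ^ 2)) u := by
  have h1 := ((hasDerivAt_inv hu.ne').const_mul A)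
  have h2 := (((bs_deriv u).inv (bs_pos u).ne').const_mul B)
  have hp := bs_pos u
  have := h1.add h2
  have e : ph A B = (fun y => A * y⁻¹) + (fun y => B * (bs⁻¹) y) := by
    ext y; simp [ph, div_eq_mul_inv]
  rw [e]
  refine this.congr_deriv ?_
  unfold bb
  field_simp
  ring

lemma Fe_deriv {A B u : ℝ} (hB : B ≠ 0) (hu : 0 < u) :
    HasDerivAt (Fe A B) (Fe A B u * (Complex.I * ((-(B * (bb u + A / B) / u ^ 2) : ℝ) : ℂ))) u :=
  (((ph_deriv hB hu).ofReal_comp).const_mul Complex.I).cexp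

noncomputable def KU (U : ℝ) : ℝ := 4 / mU U + 3 ^ 3 / mU U ^ 2

lemma bs_inv_five (u : ℝ) : 1 / bs u ^ 5 ≤ 3 ^ 3 := by
  have h : (1/3 : ℝ) ≤ bs u ^ 2 := by rw [bs_sq]; nlinarith [sq_nonneg u]
  have hp := bs_pos u
  have h2 : (1/3 : ℝ) ≤ bs u := by nlinarith
  have h4 : (1/3 : ℝ) * (1/3) ≤ bs u ^ 2 * bs u ^ 2 := by gcongr
  have h5 : (1/3 : ℝ) * (1/3) * (1/3) ≤ bs u ^ 2 * bs u ^ 2 * bs u := by gcongr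
  rw [div_le_iff₀ (by positivity)]
  nlinarith

lemma vdc {U A B u0 α β r : ℝ} (hB : B ≠ 0) (hu0 : u0 ∈ Set.Icc 0 U)
    (hc : ∀ u ∈ Set.Icc 0 U, |bb u - bb u0| ≤ |bb u + A / B|)
    (hα : 0 < α) (hαβ : α ≤ β) (hβ : β ≤ U) (hr : 0 < r) (h : u0 + r ≤ α ∨ β ≤ u0 - r) :
    ‖∫ u in α..β, Fe A B u‖ ≤ KU U / (|B| * r) := by
  have hm := mU_pos U
  set m := mU U with hmdef
  have hBa : 0 < |B| := abs_pos.mpr hB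
  have hfar : ∀ u ∈ Set.Icc α β, r ≤ |u - u0| := by
    intro u hu
    rcases h with h | h
    · exact le_trans (by linarith [hu.1]) (le_abs_self _)
    · exact le_trans (by linarith [hu.2]) (neg_le_abs _)
  have hD : ∀ u ∈ Set.Icc α β, m * (|u - u0| * (u ^ 2 + u * u0 + u0 ^ 2)) ≤ |bb u + A / B| := by
    intro u hu
    have hu' : u ∈ Set.Icc 0 U := ⟨by linarith [hu.1], by linarith [hu.2]⟩
    exact (bb_lower hu' hu0).trans (hc u hu')
  have hDpos : ∀ u ∈ Set.Icc α β, 0 < |bb u + A / B| := by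
    intro u hu
    refine lt_of_lt_of_le ?_ (hD u hu)
    have := hfar u hu
    have h0 : 0 < u := by linarith [hu.1]
    have := hu0.1
    have : 0 < |u - u0| := by linarith
    positivity
  -- the amplitude
  let V : ℝ → ℝ := fun u => u ^ 2 / (bb u + A / B)
  let V' : ℝ → ℝ := fun u => (2 * u * (bb u + A / B) - u ^ 2 * (u ^ 2 / bs u ^ 5)) / (bb u + A / B) ^ 2
  have hV : ∀ u ∈ Set.Icc α β, HasDerivAt V (V' u) u := by
    intro u hu
    have := (hasDerivAt_pow 2 u).div ((bb_deriv u).add_const (A / B)) (abs_pos.mp (hDpos u hu))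
    refine (show HasDerivAt V _ u from this).congr_deriv ?_
    simp [V']
  let k : ℂ := Complex.I / B
  have hk : ‖k‖ = 1 / |B| := by simp [k]
  have hH : ∀ u ∈ Set.Icc α β, HasDerivAt (fun u => k * (Fe A B u * (V u : ℂ)))
      (Fe A B u + k * (Fe A B u * (V' u : ℂ))) u := by
    intro u hu
    have hu0' : 0 < u := by linarith [hu.1]
    have := ((Fe_deriv (A := A) hB hu0').mul (hV u hu).ofReal_comp).const_mul k
    refine (show HasDerivAt (fun u => k * (Fe A B u * (V u : ℂ))) _ u from this).congr_deriv ?_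
    have hd : ((bb u + A / B : ℝ) : ℂ) ≠ 0 := by exact_mod_cast abs_pos.mp (hDpos u hu)
    have hBc : (B : ℂ) ≠ 0 := by exact_mod_cast hB
    have huc : (u : ℂ) ≠ 0 := by exact_mod_cast hu0'.ne'
    rw [mul_add]
    congr 1
    have e1 : ((-(B * (bb u + A / B) / u ^ 2) : ℝ) : ℂ) = -((B:ℂ) * ((bb u + A / B : ℝ) : ℂ) / (u:ℂ) ^ 2) := by
      push_cast; ring
    have e2 : (V u : ℂ) = (u : ℂ) ^ 2 / ((bb u + A / B : ℝ) : ℂ) := by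
      simp only [V]; push_cast; ring
    rw [e1, e2]
    simp only [k]
    generalize ((bb u + A / B : ℝ) : ℂ) = d at *
    field_simp
    linear_combination (-(Fe A B u)) * Complex.I_sq
  have hFc : ContinuousOn (Fe A B) (Set.Icc α β) := fun u hu =>
    (Fe_deriv hB (by linarith [hu.1])).continuousAt.continuousWithinAt
  have hV'c : ContinuousOn V' (Set.Icc α β) := by
    have h1 := bb_cont
    have h2 := bs_cont
    apply ContinuousOn.div
    · have : ∀ u, bs u ^ 5 ≠ 0 := fun u => (pow_pos (bs_pos u) 5).ne'
      exact Continuous.continuousOn (by fun_prop (disch := assumption))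
    · exact Continuous.continuousOn (by fun_prop)
    · intro u hu
      exact pow_ne_zero _ (abs_pos.mp (hDpos u hu))
  have hFV : ContinuousOn (fun u => k * (Fe A B u * (V' u : ℂ))) (Set.Icc α β) :=
    continuousOn_const.mul (hFc.mul (Complex.continuous_ofReal.comp_continuousOn hV'c))
  have hii2 : IntervalIntegrable (fun u => k * (Fe A B u * (V' u : ℂ))) volume α β :=
    ContinuousOn.intervalIntegrable_of_Icc hαβ hFV
  have hftc := intervalIntegral.integral_eq_sub_of_hasDerivAt (a := α) (b := β)
    (f := fun u => k * (Fe A B u * (V u : ℂ)))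
    (by rw [Set.uIcc_of_le hαβ]; exact hH) ((Fe_ii A B α β).add hii2)
  rw [intervalIntegral.integral_add (Fe_ii A B α β) hii2] at hftc
  -- bounds
  have hVb : ∀ u ∈ Set.Icc α β, |V u| ≤ 1 / (m * r) := by
    intro u hu
    have hu0' : 0 < u := by linarith [hu.1]
    have h1 := hD u hu
    have h2 := hfar u hu
    have h3 := hu0.1
    simp only [V]
    rw [abs_div, abs_of_pos (by positivity : 0 < u ^ 2), div_le_div_iff₀ (hDpos u hu) (by positivity), one_mul]
    refine le_trans ?_ h1
    have : r * u ^ 2 ≤ |u - u0| * (u ^ 2 + u * u0 + u0 ^ 2) := by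
      gcongr
      nlinarith [mul_nonneg hu0'.le h3, sq_nonneg u0]
    nlinarith
  have hV'b : ∀ u ∈ Set.Icc α β, |V' u| ≤ (2 / m + 3 ^ 3 / m ^ 2) * (1 / (u - u0) ^ 2) := by
    intro u hu
    have hu0' : 0 < u := by linarith [hu.1]
    have h1 := hD u hu
    have h2 := hfar u hu
    have h3 := hu0.1
    have hd := hDpos u hu
    have hdd : bb u + A / B ≠ 0 := abs_pos.mp hd
    have hx : 0 < |u - u0| := by linarith
    have e : V' u = 2 * u / (bb u + A / B) - u ^ 4 * (1 / bs u ^ 5) / (bb u + A / B) ^ 2 := by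
      simp only [V']; field_simp
    have a1 : |2 * u / (bb u + A / B)| ≤ 2 / m * (1 / (u - u0) ^ 2) := by
      rw [abs_div, abs_of_pos (by positivity : 0 < 2 * u), ← sq_abs (u - u0), div_mul_div_comm,
        div_le_div_iff₀ hd (by positivity)]
      have t : |u - u0| ≤ u + u0 := abs_le.mpr ⟨by linarith, by linarith⟩
      have : u * |u - u0| ^ 2 ≤ |u - u0| * (u ^ 2 + u * u0 + u0 ^ 2) := by
        have := mul_le_mul_of_nonneg_left t (mul_nonneg hu0'.le hx.le)
        nlinarith [mul_nonneg hx.le (sq_nonneg u0)]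
      nlinarith
    have a2 : |u ^ 4 * (1 / bs u ^ 5) / (bb u + A / B) ^ 2| ≤ 3 ^ 3 / m ^ 2 * (1 / (u - u0) ^ 2) := by
      have hb := bs_inv_five u
      have hbp : 0 < 1 / bs u ^ 5 := by have := bs_pos u; positivity
      rw [abs_of_nonneg (by positivity), ← sq_abs (bb u + A / B), ← sq_abs (u - u0), div_mul_div_comm,
        div_le_div_iff₀ (by positivity) (by positivity)]
      have t : m * (|u - u0| * u ^ 2) ≤ |bb u + A / B| := by
        refine le_trans ?_ h1
        gcongr
        nlinarith [mul_nonneg hu0'.le h3, sq_nonneg u0]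
      have t2 := pow_le_pow_left₀ (by positivity) t 2
      calc u ^ 4 * (1 / bs u ^ 5) * (m ^ 2 * |u - u0| ^ 2)
          = (1 / bs u ^ 5) * (m * (|u - u0| * u ^ 2)) ^ 2 := by ring
        _ ≤ 3 ^ 3 * |bb u + A / B| ^ 2 := by gcongr
        _ = 3 ^ 3 * 1 * |bb u + A / B| ^ 2 := by ring
    rw [e]
    calc _ ≤ _ := abs_sub _ _
      _ ≤ _ := add_le_add a1 a2
      _ = _ := by ring
  set Q := 2 / m + 3 ^ 3 / m ^ 2 with hQ
  have hQp : 0 < Q := by positivity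
  have hne : ∀ u ∈ Set.Icc α β, u - u0 ≠ 0 := by
    intro u hu
    exact abs_pos.mp (lt_of_lt_of_le hr (hfar u hu))
  have hIntegr : IntervalIntegrable (fun u => 1 / |B| * (Q * (1 / (u - u0) ^ 2))) volume α β := by
    apply ContinuousOn.intervalIntegrable_of_Icc hαβ
    refine continuousOn_const.mul (continuousOn_const.mul (continuousOn_const.div (by fun_prop) ?_))
    intro u hu
    exact pow_ne_zero _ (hne u hu)
  have hval : ∫ u in α..β, 1 / |B| * (Q * (1 / (u - u0) ^ 2)) =
      1 / |B| * (Q * (-(β - u0)⁻¹)) - 1 / |B| * (Q * (-(α - u0)⁻¹)) := by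
    refine intervalIntegral.integral_eq_sub_of_hasDerivAt (f := fun u => 1 / |B| * (Q * (-(u - u0)⁻¹))) ?_ hIntegr
    rw [Set.uIcc_of_le hαβ]
    intro u hu
    have := (((hasDerivAt_id u).sub_const u0).inv (hne u hu)).neg
    have := (this.const_mul Q).const_mul (1 / |B|)
    refine (show HasDerivAt (fun u => 1 / |B| * (Q * (-(u - u0)⁻¹))) _ u from this).congr_deriv ?_
    simp only [id]
    ring
  have herr : ‖∫ u in α..β, k * (Fe A B u * (V' u : ℂ))‖ ≤ 1 / |B| * (Q * (1 / r)) := by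
    refine (intervalIntegral.norm_integral_le_of_norm_le hαβ (g := fun u => 1 / |B| * (Q * (1 / (u - u0) ^ 2))) ?_ hIntegr).trans ?_
    · filter_upwards with u hu
      rw [norm_mul, norm_mul, Fe_norm, hk, one_mul, Complex.norm_real, Real.norm_eq_abs]
      gcongr
      exact hV'b u (Set.Ioc_subset_Icc_self hu)
    · rw [hval, ← mul_sub, ← mul_sub]
      gcongr
      rcases h with h | h
      · have : (α - u0)⁻¹ ≤ 1 / r := by rw [inv_eq_one_div]; gcongr; linarith
        have : 0 ≤ (β - u0)⁻¹ := inv_nonneg.mpr (by linarith)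
        linarith
      · have : (u0 - β)⁻¹ ≤ 1 / r := by rw [inv_eq_one_div]; gcongr; linarith
        have e : (β - u0)⁻¹ = - (u0 - β)⁻¹ := by rw [← neg_sub, inv_neg]
        have : (α - u0)⁻¹ ≤ 0 := inv_nonpos.mpr (by linarith)
        linarith
  have hbd : ∀ u ∈ Set.Icc α β, ‖k * (Fe A B u * (V u : ℂ))‖ ≤ 1 / |B| * (1 / (m * r)) := by
    intro u hu
    rw [norm_mul, norm_mul, Fe_norm, hk, one_mul, Complex.norm_real, Real.norm_eq_abs]
    gcongr
    exact hVb u hu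
  rw [eq_sub_of_add_eq hftc]
  calc _ ≤ _ := norm_sub_le _ _
    _ ≤ _ := add_le_add (norm_sub_le _ _) le_rfl
    _ ≤ (1 / |B| * (1 / (m * r)) + 1 / |B| * (1 / (m * r))) + 1 / |B| * (Q * (1 / r)) :=
        add_le_add (add_le_add (hbd β ⟨hαβ, le_rfl⟩) (hbd α ⟨le_rfl, hαβ⟩)) herr
    _ = KU U / (|B| * r) := by
        rw [hQ]; unfold KU; rw [← hmdef]; field_simp; ring

lemma triv (A B : ℝ) {a b : ℝ} (h : a ≤ b) : ‖∫ u in a..b, Fe A B u‖ ≤ b - a := by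
  have := intervalIntegral.norm_integral_le_of_norm_le_const (a := a) (b := b) (f := Fe A B) (C := 1)
    (fun x _ => (Fe_norm A B x).le)
  rwa [one_mul, abs_of_nonneg (by linarith)] at this

lemma KU_pos (U : ℝ) : 0 < KU U := by have := mU_pos U; unfold KU; positivity

lemma osc {U : ℝ} (hU : 0 < U) (A : ℝ) {B : ℝ} (hB : B ≠ 0) :
    ‖∫ u in (0:ℝ)..U, Fe A B u‖ ≤ (3 + 2 * KU U) * (1 / Real.sqrt |B|) := by
  obtain ⟨u0, hu0, hc⟩ := exists_u0 hU (A / B)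
  have hBa : 0 < |B| := abs_pos.mpr hB
  have hsq : 0 < Real.sqrt |B| := Real.sqrt_pos.mpr hBa
  set r := 1 / Real.sqrt |B| with hr
  have hrp : 0 < r := by positivity
  have hBr : KU U / (|B| * r) = KU U * r := by
    rw [hr]
    nth_rw 1 [← Real.mul_self_sqrt hBa.le]
    field_simp
  have hK := KU_pos U
  have hKr : 0 < KU U * r := by positivity
  set α := min r U with hα
  have hα0 : 0 < α := lt_min hrp hU
  have hαr : α ≤ r := min_le_left _ _
  have hαU : α ≤ U := min_le_right _ _
  set p := max α (u0 - r) with hp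
  set q := max α (min U (u0 + r)) with hq
  have hαp : α ≤ p := le_max_left _ _
  have hpU : p ≤ U := max_le hαU (by linarith [hu0.2])
  have hqU : q ≤ U := max_le hαU (min_le_left _ _)
  have hpq : p ≤ q := max_le_max le_rfl (le_min (by linarith [hu0.2]) (by linarith))
  have hqp : q - p ≤ 2 * r := by
    have h1 : q ≤ p + 2 * r := by
      apply max_le
      · linarith
      · have := le_max_right α (u0 - r)
        have := min_le_right U (u0 + r)
        linarith
    linarith
  have b1 : ‖∫ u in (0:ℝ)..α, Fe A B u‖ ≤ r := (triv A B hα0.le).trans (by linarith)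
  have b2 : ‖∫ u in α..p, Fe A B u‖ ≤ KU U * r := by
    rcases le_total α (u0 - r) with h | h
    · have e : p = u0 - r := max_eq_right h
      rw [← hBr]
      exact vdc hB hu0 hc hα0 hαp hpU hrp (Or.inr e.le)
    · have e : p = α := max_eq_left h
      rw [e]; simpa using hKr.le
  have b3 : ‖∫ u in p..q, Fe A B u‖ ≤ 2 * r := (triv A B hpq).trans hqp
  have b4 : ‖∫ u in q..U, Fe A B u‖ ≤ KU U * r := by
    rcases le_total U (u0 + r) with h | h
    · have e : q = U := by rw [hq, min_eq_left h, max_eq_right hαU]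
      rw [e]; simpa using hKr.le
    · rw [← hBr]
      refine vdc hB hu0 hc (by linarith) hqU le_rfl hrp (Or.inl ?_)
      rw [hq, min_eq_right h]; exact le_max_right _ _
  have i := Fe_ii A B
  rw [← intervalIntegral.integral_add_adjacent_intervals (i 0 α) (i α U),
    ← intervalIntegral.integral_add_adjacent_intervals (i α p) (i p U),
    ← intervalIntegral.integral_add_adjacent_intervals (i p q) (i q U)]
  calc _ ≤ _ := norm_add_le _ _
    _ ≤ _ := add_le_add le_rfl (norm_add_le _ _)
    _ ≤ _ := add_le_add le_rfl (add_le_add le_rfl (norm_add_le _ _))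
    _ ≤ r + (KU U * r + (2 * r + KU U * r)) := add_le_add b1 (add_le_add b2 (add_le_add b3 b4))
    _ = _ := by ring

noncomputable def Jk (σ τ μ z ξ : ℝ) : ℂ :=
  Complex.exp (Complex.I * (z * ξ : ℝ)) * prop1 σ τ μ ξ * ((1 / (μ * ξ ^ 2) : ℝ) : ℂ)

lemma image_pos {κ U : ℝ} (hκ : 0 < κ) (hU : 0 < U) :
    (fun u : ℝ => 1 / (κ * u)) '' Set.Ioc 0 U = Set.Ici (1 / (κ * U)) := by
  ext ξ
  simp only [Set.mem_image, Set.mem_Ioc, Set.mem_Ici]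
  constructor
  · rintro ⟨u, ⟨h0, h1⟩, rfl⟩
    gcongr
  · intro h
    have h0 : 0 < ξ := lt_of_lt_of_le (by positivity) h
    refine ⟨1 / (κ * ξ), ⟨by positivity, ?_⟩, by field_simp⟩
    rw [div_le_iff₀ (by positivity)] at h ⊢
    linarith

lemma image_neg {κ U : ℝ} (hκ : 0 < κ) (hU : 0 < U) :
    (fun u : ℝ => -1 / (κ * u)) '' Set.Ioc 0 U = Set.Iic (-(1 / (κ * U))) := by
  have := congrArg (fun s => Neg.neg '' s) (image_pos hκ hU)
  simp only [Set.image_image, Set.image_neg_eq_neg, Set.neg_Ici] at this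
  rw [← this]
  congr 1
  ext u
  ring

lemma image_fun {e σ τ μ z u : ℝ} (he : e = 1 ∨ e = -1) (hμ : 0 < μ) (hu : 0 < u) :
    |-e / (Real.sqrt μ * u ^ 2)| • Jk σ τ μ z (e / (Real.sqrt μ * u)) =
      ((1 / Real.sqrt μ : ℝ) : ℂ) * Fe (e * z / Real.sqrt μ) (e * σ * τ / Real.sqrt μ) u := by
  have hκ : 0 < Real.sqrt μ := Real.sqrt_pos.mpr hμ
  have hμκ : μ = Real.sqrt μ ^ 2 := (Real.sq_sqrt hμ.le).symm
  set κ := Real.sqrt μ with hk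
  have hee : e ^ 2 = 1 := by rcases he with h | h <;> rw [h] <;> norm_num
  have hea : |e| = 1 := by rcases he with h | h <;> rw [h] <;> norm_num
  have h1 : |-e / (κ * u ^ 2)| = 1 / (κ * u ^ 2) := by
    rw [abs_div, abs_neg, hea, abs_of_pos (by positivity)]
  have h2 : 1 / (μ * (e / (κ * u)) ^ 2) = u ^ 2 := by
    rw [div_pow, hee, hμκ]; field_simp
  have h3 : Real.sqrt (1 + μ * (e / (κ * u)) ^ 2 / 3) = bs u / u := by
    have : 1 + μ * (e / (κ * u)) ^ 2 / 3 = (u ^ 2 + 1 / 3) / u ^ 2 := by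
      rw [div_pow, hee, hμκ]; field_simp
    rw [this, Real.sqrt_div (by positivity), Real.sqrt_sq hu.le]; rfl
  have hb := bs_pos u
  unfold Jk prop1 Fe ph
  rw [h1, h2, h3, ← Complex.exp_add, ← mul_add, ← Complex.ofReal_add]
  have h4 : z * (e / (κ * u)) + σ * τ * (e / (κ * u)) / (bs u / u) =
      e * z / κ / u + e * σ * τ / κ / bs u := by field_simp
  rw [h4, Complex.real_smul]
  have h5 : ((1 / κ : ℝ) : ℂ) = ((1 / (κ * u ^ 2) : ℝ) : ℂ) * ((u ^ 2 : ℝ) : ℂ) := by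
    rw [← Complex.ofReal_mul]; congr 1; field_simp
  rw [h5]; ring

lemma piece {e σ τ μ z U : ℝ} (he : e = 1 ∨ e = -1) (hσ : σ = 1 ∨ σ = -1) (hμ : 0 < μ) (hU : 0 < U)
    (hτ : τ ≠ 0) :
    IntegrableOn (Jk σ τ μ z) ((fun u : ℝ => e / (Real.sqrt μ * u)) '' Set.Ioc 0 U) ∧
    ‖∫ ξ in (fun u : ℝ => e / (Real.sqrt μ * u)) '' Set.Ioc 0 U, Jk σ τ μ z ξ‖ ≤
      1 / Real.sqrt μ * ((3 + 2 * KU U) * (1 / Real.sqrt (|τ| / Real.sqrt μ))) := by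
  have hκ : 0 < Real.sqrt μ := Real.sqrt_pos.mpr hμ
  have he0 : e ≠ 0 := by rcases he with h | h <;> rw [h] <;> norm_num
  have hea : |e| = 1 := by rcases he with h | h <;> rw [h] <;> norm_num
  have hσ0 : σ ≠ 0 := by rcases hσ with h | h <;> rw [h] <;> norm_num
  have hσa : |σ| = 1 := by rcases hσ with h | h <;> rw [h] <;> norm_num
  have hd : ∀ u ∈ Set.Ioc 0 U, HasDerivWithinAt (fun u : ℝ => e / (Real.sqrt μ * u))
      (-e / (Real.sqrt μ * u ^ 2)) (Set.Ioc 0 U) u := by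
    intro u hu
    have hu0 := hu.1
    have := (((hasDerivAt_id u).const_mul (Real.sqrt μ)).inv (by simp; exact ⟨hκ.ne', hu0.ne'⟩)).const_mul e
    refine ((show HasDerivAt (fun u : ℝ => e / (Real.sqrt μ * u)) _ u from this).congr_deriv ?_).hasDerivWithinAt
    simp only [id]
    field_simp
  have hinj : Set.InjOn (fun u : ℝ => e / (Real.sqrt μ * u)) (Set.Ioc 0 U) := by
    intro u hu v hv h
    have := hu.1
    have := hv.1
    simp only at h
    field_simp at h
    exact h.symm
  have hcongr : Set.EqOn (fun u => |-e / (Real.sqrt μ * u ^ 2)| • Jk σ τ μ z (e / (Real.sqrt μ * u)))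
      (fun u => ((1 / Real.sqrt μ : ℝ) : ℂ) * Fe (e * z / Real.sqrt μ) (e * σ * τ / Real.sqrt μ) u)
      (Set.Ioc 0 U) := fun u hu => image_fun he hμ hu.1
  constructor
  · rw [integrableOn_image_iff_integrableOn_abs_deriv_smul measurableSet_Ioc hd hinj]
    rw [integrableOn_congr_fun hcongr measurableSet_Ioc]
    exact ((intervalIntegrable_iff_integrableOn_Ioc_of_le hU.le).mp (Fe_ii _ _ 0 U)).const_mul _
  · rw [integral_image_eq_integral_abs_deriv_smul measurableSet_Ioc hd hinj,
      setIntegral_congr_fun measurableSet_Ioc hcongr, integral_const_mul, norm_mul,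
      Complex.norm_real, Real.norm_of_nonneg (by positivity), ← intervalIntegral.integral_of_le hU.le]
    gcongr
    have := osc hU (e * z / Real.sqrt μ) (B := e * σ * τ / Real.sqrt μ)
      (by positivity)
    rwa [abs_div, abs_mul, abs_mul, hea, hσa, one_mul, one_mul, abs_of_pos hκ] at this

def SS (μ U : ℝ) : Set ℝ := Set.Ici (1 / (Real.sqrt μ * U)) ∪ Set.Iic (-(1 / (Real.sqrt μ * U)))

lemma SS_meas (μ U : ℝ) : MeasurableSet (SS μ U) := measurableSet_Ici.union measurableSet_Iic

lemma kernel {σ τ μ U : ℝ} (z : ℝ) (hσ : σ = 1 ∨ σ = -1) (hμ : 0 < μ) (hU : 0 < U) (hτ : τ ≠ 0) :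
    IntegrableOn (Jk σ τ μ z) (SS μ U) ∧
    ‖∫ ξ in SS μ U, Jk σ τ μ z ξ‖ ≤
      1 / Real.sqrt μ * (2 * (3 + 2 * KU U) * (1 / Real.sqrt (|τ| / Real.sqrt μ))) := by
  have hκ : 0 < Real.sqrt μ := Real.sqrt_pos.mpr hμ
  obtain ⟨i1, n1⟩ := piece (e := 1) (z := z) (Or.inl rfl) hσ hμ hU hτ
  obtain ⟨i2, n2⟩ := piece (e := -1) (z := z) (Or.inr rfl) hσ hμ hU hτ
  rw [image_pos hκ hU] at i1 n1
  rw [image_neg hκ hU] at i2 n2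
  refine ⟨i1.union i2, ?_⟩
  unfold SS
  rw [setIntegral_union ?_ measurableSet_Iic i1 i2]
  · refine (norm_add_le _ _).trans ((add_le_add n1 n2).trans (le_of_eq ?_))
    ring
  · rw [Set.disjoint_left]
    intro x hx hx'
    have : 0 < 1 / (Real.sqrt μ * U) := by positivity
    simp only [Set.mem_Ici, Set.mem_Iic] at hx hx'
    linarith

/-- the normalising constant -/
noncomputable def c0 : ℝ := (2 * π) ^ (-(1 : ℝ) / 2)

lemma c0_pos : 0 < c0 := by unfold c0; positivity
lemma c0_sq_s11 : c0 * c0 * (2 * π) = 1 := by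
  have h : (0:ℝ) < 2 * π := by positivity
  unfold c0
  rw [← Real.rpow_add h]
  norm_num
  rw [Real.rpow_neg_one]
  field_simp

lemma ft1_eq_s11 (g : ℝ → ℂ) (ξ : ℝ) : ft1 g ξ = (c0 : ℂ) * FourierTransform.fourier g (ξ / (2 * π)) := by
  rw [Real.fourier_real_eq_integral_exp_smul]
  unfold ft1 c0
  congr 2
  ext x
  rw [smul_eq_mul]
  congr 2
  have : -2 * π * x * (ξ / (2 * π)) = -(x * ξ) := by field_simp
  rw [this]
  push_cast; ring

/-- inverse transform in the paper's normalisation -/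
lemma inv_eq (G : ℝ → ℂ) (x : ℝ) :
    (c0 : ℂ) * ∫ ξ : ℝ, Complex.exp (Complex.I * (x * ξ : ℝ)) * G ξ =
      FourierTransformInv.fourierInv (fun ζ : ℝ => ((c0 * (2 * π) : ℝ) : ℂ) * G (2 * π * ζ)) x := by
  rw [Real.fourierInv_eq']
  have h2 : (0:ℝ) < 2 * π := by positivity
  have := Measure.integral_comp_mul_left
    (fun ξ : ℝ => Complex.exp (Complex.I * (x * ξ : ℝ)) * G ξ) (2 * π)
  rw [abs_of_pos (by positivity)] at this
  have e : ∫ v : ℝ, Complex.exp ((↑(2 * π * (inner ℝ v x)) * Complex.I)) •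
        (((c0 * (2 * π) : ℝ) : ℂ) * G (2 * π * v)) =
      ((c0 * (2 * π) : ℝ) : ℂ) * ∫ v : ℝ, Complex.exp (Complex.I * (x * (2 * π * v) : ℝ)) * G (2 * π * v) := by
    rw [← integral_const_mul]
    congr 1
    ext v
    have : 2 * π * (inner ℝ v x) = x * (2 * π * v) := by
      simp; ring
    rw [this, smul_eq_mul, mul_comm Complex.I]
    ring
  rw [e, this, Complex.real_smul, ← mul_assoc, ← Complex.ofReal_mul]
  congr 2
  field_simp

lemma inversion {G : ℝ → ℂ} (hGc : Continuous G) (hGi : Integrable G)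
    (hg : Integrable (fun x : ℝ => (c0 : ℂ) * ∫ ξ : ℝ, Complex.exp (Complex.I * (x * ξ : ℝ)) * G ξ)) (ξ : ℝ) :
    ft1 (fun x : ℝ => (c0 : ℂ) * ∫ ξ : ℝ, Complex.exp (Complex.I * (x * ξ : ℝ)) * G ξ) ξ = G ξ := by
  have h2 : (0:ℝ) < 2 * π := by positivity
  simp_rw [inv_eq] at hg ⊢
  rw [ft1_eq_s11]
  set H : ℝ → ℂ := (fun ζ : ℝ => ((c0 * (2 * π) : ℝ) : ℂ) * G (2 * π * ζ)) with hH
  have hHc : Continuous H := by fun_prop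
  have hHi : Integrable H := (hGi.comp_mul_left' h2.ne').const_mul _
  have hF : Integrable (FourierTransform.fourier H) := by
    have := hg.comp_neg
    simp_rw [Real.fourierInv_eq_fourier_neg, neg_neg] at this
    exact this
  change (c0 : ℂ) * FourierTransform.fourier (FourierTransformInv.fourierInv H) _ = _
  rw [hHc.fourier_fourierInv_eq hHi hF, hH]
  simp only
  rw [← mul_assoc, ← Complex.ofReal_mul, ← mul_assoc, c0_sq_s11, mul_div_cancel₀ _ h2.ne']
  simp

lemma inv_cont {G : ℝ → ℂ} (hGi : Integrable G) :
    Continuous (fun x : ℝ => (c0 : ℂ) * ∫ ξ : ℝ, Complex.exp (Complex.I * (x * ξ : ℝ)) * G ξ) := by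
  refine continuous_const.mul ?_
  refine continuous_of_dominated (bound := fun ξ => ‖G ξ‖) ?_ ?_ hGi.norm ?_
  · intro x
    exact (Continuous.aestronglyMeasurable (by fun_prop)).mul hGi.aestronglyMeasurable
  · intro x
    filter_upwards with ξ
    rw [norm_mul, mul_comm Complex.I, Complex.norm_exp_ofReal_mul_I, one_mul]
  · filter_upwards with ξ
    fun_prop

lemma fubini {σ τ μ U : ℝ} (hσ : σ = 1 ∨ σ = -1) (hμ : 0 < μ) (hU : 0 < U) (hτ : τ ≠ 0)
    {g : ℝ → ℂ} (hg : Integrable g) (x : ℝ) :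
    ‖(c0 : ℂ) * ∫ ξ in SS μ U, Jk σ τ μ x ξ * ft1 g ξ‖ ≤
      c0 * c0 * (1 / Real.sqrt μ * (2 * (3 + 2 * KU U) * (1 / Real.sqrt (|τ| / Real.sqrt μ)))) *
        ∫ y, ‖g y‖ := by
  set Kb := 1 / Real.sqrt μ * (2 * (3 + 2 * KU U) * (1 / Real.sqrt (|τ| / Real.sqrt μ)))
  have hJ := (kernel x hσ hμ hU hτ).1
  have hIntegr : Integrable (Function.uncurry fun (ξ y : ℝ) =>
      Complex.exp (-Complex.I * (y * ξ : ℝ)) * (Jk σ τ μ x ξ * g y))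
      ((volume.restrict (SS μ U)).prod volume) := by
    refine Integrable.bdd_mul (c := 1) (hJ.mul_prod hg) ?_ ?_
    · exact Continuous.aestronglyMeasurable (by fun_prop)
    · filter_upwards with p
      rw [neg_mul, ← mul_neg, ← Complex.ofReal_neg, mul_comm, Complex.norm_exp_ofReal_mul_I]
  have e1 : ∫ ξ in SS μ U, Jk σ τ μ x ξ * ft1 g ξ =
      (c0 : ℂ) * ∫ ξ in SS μ U, ∫ y, Complex.exp (-Complex.I * (y * ξ : ℝ)) * (Jk σ τ μ x ξ * g y) := by
    rw [← integral_const_mul]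
    congr 1
    ext ξ
    unfold ft1
    rw [← c0]
    rw [mul_left_comm, ← integral_const_mul]
    congr 2
    ext y
    ring
  have e2 : ∀ y : ℝ, ∫ ξ in SS μ U, Complex.exp (-Complex.I * (y * ξ : ℝ)) * (Jk σ τ μ x ξ * g y) =
      (∫ ξ in SS μ U, Jk σ τ μ (x - y) ξ) * g y := by
    intro y
    rw [← integral_mul_const]
    congr 1
    ext ξ
    unfold Jk
    have : Complex.exp (Complex.I * ((x - y) * ξ : ℝ)) =
        Complex.exp (-Complex.I * (y * ξ : ℝ)) * Complex.exp (Complex.I * (x * ξ : ℝ)) := by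
      rw [← Complex.exp_add]
      congr 1
      push_cast; ring
    rw [this]; ring
  rw [e1, integral_integral_swap hIntegr]
  simp_rw [e2]
  have hb : ‖∫ y, (∫ ξ in SS μ U, Jk σ τ μ (x - y) ξ) * g y‖ ≤ Kb * ∫ y, ‖g y‖ := by
    rw [← integral_const_mul]
    refine norm_integral_le_of_norm_le (hg.norm.const_mul Kb) ?_
    filter_upwards with y
    rw [norm_mul]
    gcongr
    exact (kernel (x - y) hσ hμ hU hτ).2
  rw [norm_mul, norm_mul, Complex.norm_real, Real.norm_of_nonneg c0_pos.le, ← mul_assoc, mul_assoc (c0 * c0)]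
  have := c0_pos
  gcongr

lemma G_props {χ : ℝ → ℝ} (hχ : Continuous χ) (hχc : HasCompactSupport χ) (μ : ℝ) (f : SchwartzMap ℝ ℂ) :
    Continuous (fun ξ : ℝ => (((1 - χ (Real.sqrt μ * |ξ|)) * (μ * ξ ^ 2) : ℝ) : ℂ) * ft1 f ξ) ∧
    Integrable (fun ξ : ℝ => (((1 - χ (Real.sqrt μ * |ξ|)) * (μ * ξ ^ 2) : ℝ) : ℂ) * ft1 f ξ) := by
  have h2 : (0:ℝ) < 2 * π := by positivity
  simp_rw [ft1_eq_s11, ← SchwartzMap.fourier_coe]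
  set h : SchwartzMap ℝ ℂ := FourierTransform.fourier f
  have hc := h.continuous
  constructor
  · fun_prop
  · obtain ⟨M, hM⟩ := hχ.bounded_above_of_compact_support hχc
    have h1 : Integrable (fun ξ : ℝ => ((ξ ^ 2 : ℝ) : ℂ) * h ξ) := by
      refine (h.integrable_pow_mul volume 2).mono' (Continuous.aestronglyMeasurable (by fun_prop)) ?_
      filter_upwards with ξ
      rw [norm_mul, Complex.norm_real, norm_pow]
    have h3 : Integrable (fun ξ : ℝ => (((ξ / (2 * π)) ^ 2 : ℝ) : ℂ) * h (ξ / (2 * π))) :=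
      h1.comp_div h2.ne'
    have h4 := h3.bdd_mul (c := (1 + M) * (|μ * (2 * π) ^ 2 * c0|))
      (f := fun ξ : ℝ => (((1 - χ (Real.sqrt μ * |ξ|)) * (μ * (2 * π) ^ 2 * c0) : ℝ) : ℂ))
      (Continuous.aestronglyMeasurable (by fun_prop)) (by
        filter_upwards with ξ
        rw [Complex.norm_real, norm_mul, Real.norm_eq_abs (μ * (2 * π) ^ 2 * c0)]
        gcongr
        refine (norm_sub_le _ _).trans ?_
        rw [norm_one]
        gcongr
        exact hM _)
    refine h4.congr ?_
    filter_upwards with ξ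
    rw [← mul_assoc, ← mul_assoc (_ : ℂ) (c0 : ℂ), ← Complex.ofReal_mul, ← Complex.ofReal_mul]
    congr 2
    field_simp

/-- High-frequency dispersive decay for the 1D Boussinesq propagator:
`‖e^{±(t/ε)∂ₓ/√(1+μD²/3)} (1−χ(√μ|D|)) f‖_{L^∞} ≤ C μ^{-1/2} (ε/|t|)^{1/2}
‖(1−χ(√μ|D|)) (√μ|D|)² f‖_{L¹}`. -/
theorem stmt11 (χ : ℝ → ℝ) (hχ : ContDiff ℝ (⊤ : ℕ∞) χ) (hχc : HasCompactSupport χ)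
    (hχ1 : ∀ᶠ y in nhds (0 : ℝ), χ y = 1) (σ : ℝ) (hσ : σ = 1 ∨ σ = -1) :
    ∃ C : ℝ, 0 < C ∧ ∀ f : SchwartzMap ℝ ℂ, ∀ t : ℝ, t ≠ 0 →
      ∀ μ ∈ Set.Ioc (0 : ℝ) 1, ∀ ε ∈ Set.Ioc (0 : ℝ) 1,
        eLpNorm
          (fmult1 (fun ξ => prop1 σ (t / ε) μ ξ *
            ((1 - χ (Real.sqrt μ * |ξ|) : ℝ) : ℂ)) ⇑f) ⊤ volume ≤
          ENNReal.ofReal (C * μ ^ (-(1 : ℝ) / 2) * (ε / |t|) ^ ((1 : ℝ) / 2)) *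
            eLpNorm
              (fmult1 (fun ξ =>
                (((1 - χ (Real.sqrt μ * |ξ|)) * (μ * ξ ^ 2) : ℝ) : ℂ)) ⇑f) 1 volume := by
  have hχ0 := hχ.continuous
  obtain ⟨δ, hδ, hδ1⟩ := Metric.eventually_nhds_iff.mp hχ1
  set U := 1 / δ with hUdef
  have hU : 0 < U := by positivity
  have hK := KU_pos U
  have hc0 := c0_pos
  refine ⟨c0 * c0 * (2 * (3 + 2 * KU U)), by positivity, ?_⟩
  intro f t ht μ hμ ε hε
  have hμ0 : 0 < μ := hμ.1
  have hε0 : 0 < ε := hε.1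
  have hκ : 0 < Real.sqrt μ := Real.sqrt_pos.mpr hμ0
  have hta : 0 < |t| := abs_pos.mpr ht
  have hτ : t / ε ≠ 0 := div_ne_zero ht hε0.ne'
  set G : ℝ → ℂ := fun ξ : ℝ => (((1 - χ (Real.sqrt μ * |ξ|)) * (μ * ξ ^ 2) : ℝ) : ℂ) * ft1 f ξ with hG
  obtain ⟨hGc, hGi⟩ := G_props hχ0 hχc μ f
  set g : ℝ → ℂ := fun x : ℝ => (c0 : ℂ) * ∫ ξ : ℝ, Complex.exp (Complex.I * (x * ξ : ℝ)) * G ξ with hgdef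
  have hgeq : fmult1 (fun ξ => (((1 - χ (Real.sqrt μ * |ξ|)) * (μ * ξ ^ 2) : ℝ) : ℂ)) ⇑f = g := by
    ext x
    simp only [fmult1, hgdef, hG, c0, mul_assoc]
  rw [hgeq]
  have hgc : Continuous g := inv_cont hGi
  have hconst : 0 < c0 * c0 * (2 * (3 + 2 * KU U)) * μ ^ (-(1 : ℝ) / 2) * (ε / |t|) ^ ((1 : ℝ) / 2) := by
    positivity
  by_cases hg : Integrable g
  swap
  · have : eLpNorm g 1 volume = ⊤ := by
      by_contra hne
      exact hg (memLp_one_iff_integrable.mp ⟨hgc.aestronglyMeasurable, lt_top_iff_ne_top.mpr hne⟩)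
    rw [this, ENNReal.mul_top (by simpa using hconst)]
    exact le_top
  have hinv : ∀ ξ, ft1 g ξ = G ξ := inversion hGc hGi hg
  rw [eLpNorm_exponent_top]
  refine eLpNormEssSup_le_of_ae_enorm_bound ?_
  filter_upwards with x
  have hT : fmult1 (fun ξ => prop1 σ (t / ε) μ ξ * ((1 - χ (Real.sqrt μ * |ξ|) : ℝ) : ℂ)) ⇑f x =
      (c0 : ℂ) * ∫ ξ in SS μ U, Jk σ (t / ε) μ x ξ * ft1 g ξ := by
    unfold fmult1
    rw [← c0, ← integral_indicator (SS_meas μ U)]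
    congr 2
    ext ξ
    by_cases hξ : ξ ∈ SS μ U
    · rw [Set.indicator_of_mem hξ, hinv]
      have hξ0 : ξ ≠ 0 := by
        rintro rfl
        have : 0 < 1 / (Real.sqrt μ * U) := by positivity
        rcases hξ with h | h
        · simp only [Set.mem_Ici] at h; linarith
        · simp only [Set.mem_Iic] at h; linarith
      simp only [Jk, hG]
      have : ((1 - χ (Real.sqrt μ * |ξ|) : ℝ) : ℂ) = ((1 / (μ * ξ ^ 2) : ℝ) : ℂ) *
          (((1 - χ (Real.sqrt μ * |ξ|)) * (μ * ξ ^ 2) : ℝ) : ℂ) := by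
        rw [← Complex.ofReal_mul]
        congr 1
        field_simp
      rw [this]; ring
    · rw [Set.indicator_of_notMem hξ]
      have hlt : |ξ| < 1 / (Real.sqrt μ * U) := by
        simp only [SS, Set.mem_union, Set.mem_Ici, Set.mem_Iic, not_or, not_le] at hξ
        exact abs_lt.mpr ⟨hξ.2, hξ.1⟩
      have : χ (Real.sqrt μ * |ξ|) = 1 := by
        apply hδ1
        rw [Real.dist_eq, sub_zero, abs_of_nonneg (by positivity)]
        rw [lt_div_iff₀ (by positivity), hUdef] at hlt
        have e : |ξ| * (Real.sqrt μ * (1 / δ)) = Real.sqrt μ * |ξ| / δ := by ring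
        rw [e, div_lt_one hδ] at hlt
        exact hlt
      simp only [this]; simp
  rw [hT, eLpNorm_one_eq_lintegral_enorm, ← ofReal_integral_norm_eq_lintegral_enorm hg,
    ← ENNReal.ofReal_mul hconst.le, ← ofReal_norm]
  apply ENNReal.ofReal_le_ofReal
  refine (fubini hσ hμ0 hU hτ hg x).trans ?_
  have hin : 0 ≤ ∫ y, ‖g y‖ := integral_nonneg fun _ => norm_nonneg _
  have hm : 1 / Real.sqrt μ = μ ^ (-(1 : ℝ) / 2) := by
    rw [Real.sqrt_eq_rpow, neg_div, Real.rpow_neg hμ0.le, one_div]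
  have hs : 1 / Real.sqrt (|t / ε| / Real.sqrt μ) ≤ (ε / |t|) ^ ((1 : ℝ) / 2) := by
    rw [← Real.sqrt_eq_rpow, ← Real.sqrt_one, ← Real.sqrt_div zero_le_one]
    apply Real.sqrt_le_sqrt
    rw [abs_div, abs_of_pos hε0]
    have h1 : Real.sqrt μ ≤ 1 := Real.sqrt_le_one.mpr hμ.2
    have e : 1 / (|t| / ε / Real.sqrt μ) = ε / |t| * Real.sqrt μ := by field_simp
    rw [e]
    exact mul_le_of_le_one_right (by positivity) h1
  refine mul_le_mul_of_nonneg_right ?_ hin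
  rw [hm]
  calc _ ≤ c0 * c0 * (μ ^ (-(1 : ℝ) / 2) * (2 * (3 + 2 * KU U) * (ε / |t|) ^ ((1 : ℝ) / 2))) := by gcongr
    _ = _ := by ring
end
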